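/- arXiv:2603.11038 — 4 statements merged into one kernel-verified Lean document; each statement's English description precedes it below -/
import Mathlib

section
/- Let F = F_q be a finite field, d ≥ 1, and M an M_d-matrix over F_q. Then E_{p_d ∈ F_q^n}[CR(M[p_d])] ≥ (1 − 1/q) · CR(M), where the expectation is over a uniformly random p_d ∈ F_q^n and M[p_d] is the matrix of multilinear forms in the blocks x_1,…,x_{d−1} obtained by substituting x_d = p_d. -/
open MvPolynomial

section Defs

variable {F : Type*} [Field F]

/-- A polynomial in the block variables `x_{i,j}` (`i ∈ Fin d`, `j ∈ Fin n`) is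
multilinear exactly in the blocks of `S`: every monomial has degree 1 in each block
`i ∈ S` and degree 0 in each block `i ∉ S`. -/
def IsMultilinearOn {d n : ℕ} (S : Finset (Fin d))
    (f : MvPolynomial (Fin d × Fin n) F) : Prop :=
  ∀ m ∈ f.support, ∀ i : Fin d,
    (∑ j : Fin n, m (i, j)) = if i ∈ S then 1 else 0

/-- A multilinear form: degree 1 in every block of variables. -/
def IsMultilinear {d n : ℕ} (f : MvPolynomial (Fin d × Fin n) F) : Prop :=
  IsMultilinearOn Finset.univ f

/-- Commutative rank: the rank of the matrix over the field of fractions of the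
polynomial ring. -/
noncomputable def CR {σ : Type*} {α β : Type*} [Fintype β]
    (M : Matrix α β (MvPolynomial σ F)) : ℕ :=
  (M.map (algebraMap (MvPolynomial σ F) (FractionRing (MvPolynomial σ F)))).rank

/-- `M` is the sum of `r` outer products `u ⊗ v`, where `u` has entries multilinear
in the blocks of some `S ⊆ [d]` and `v` has entries multilinear in the complementary
blocks. -/
def HasPRDecomp {d n a b : ℕ}
    (M : Matrix (Fin a) (Fin b) (MvPolynomial (Fin d × Fin n) F)) (r : ℕ) : Prop :=
  ∃ (S : Fin r → Finset (Fin d))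
    (u : Fin r → Fin a → MvPolynomial (Fin d × Fin n) F)
    (v : Fin r → Fin b → MvPolynomial (Fin d × Fin n) F),
    (∀ t i, IsMultilinearOn (S t) (u t i)) ∧
    (∀ t j, IsMultilinearOn (S t)ᶜ (v t j)) ∧
    M = ∑ t, Matrix.of fun i j => u t i * v t j

/-- Partition rank of a matrix of multilinear forms. -/
noncomputable def PR {d n a b : ℕ}
    (M : Matrix (Fin a) (Fin b) (MvPolynomial (Fin d × Fin n) F)) : ℕ :=
  sInf {r | HasPRDecomp M r}

/-- Evaluation of a matrix of multilinear forms at a point `p ∈ (F^n)^d`. -/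
noncomputable def evalMat {d n : ℕ} {α β : Type*}
    (M : Matrix α β (MvPolynomial (Fin d × Fin n) F)) (p : Fin d → Fin n → F) :
    Matrix α β F :=
  M.map (eval fun v => p v.1 v.2)

/-- Max-rank: the largest rank of a scalar evaluation. -/
noncomputable def MaxR {d n : ℕ} {α β : Type*} [Fintype β]
    (M : Matrix α β (MvPolynomial (Fin d × Fin n) F)) : ℕ :=
  ⨆ p : Fin d → Fin n → F, (evalMat M p).rank

/-- Partial evaluation: substitute `x_i := p_i` for `i ∈ S`, leaving the other
blocks of variables untouched. -/
noncomputable def pevalMat {d n : ℕ} {α β : Type*}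
    (M : Matrix α β (MvPolynomial (Fin d × Fin n) F)) (S : Finset (Fin d))
    (p : Fin d → Fin n → F) :
    Matrix α β (MvPolynomial (Fin d × Fin n) F) :=
  M.map (aeval fun v : Fin d × Fin n => if v.1 ∈ S then C (p v.1 v.2) else X v)

end Defs

section D1

variable {F : Type*} [Field F]

/-- Partition-rank decomposition for matrices of linear forms: a sum of `r` outer
products, each either (scalars) ⊗ (linear forms) or (linear forms) ⊗ (scalars). -/
def HasPR1Decomp {n a b : ℕ}
    (M : Matrix (Fin a) (Fin b) (MvPolynomial (Fin n) F)) (r : ℕ) : Prop :=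
  ∃ (c : Fin r → Bool)
    (u : Fin r → Fin a → MvPolynomial (Fin n) F)
    (v : Fin r → Fin b → MvPolynomial (Fin n) F),
    (∀ t i, (u t i).IsHomogeneous (if c t then 0 else 1)) ∧
    (∀ t j, (v t j).IsHomogeneous (if c t then 1 else 0)) ∧
    M = ∑ t, Matrix.of fun i j => u t i * v t j

/-- Partition rank of a matrix of linear forms. -/
noncomputable def PR1 {n a b : ℕ}
    (M : Matrix (Fin a) (Fin b) (MvPolynomial (Fin n) F)) : ℕ :=
  sInf {r | HasPR1Decomp M r}

/-- Max-rank of a matrix of linear forms. -/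
noncomputable def MaxR1 {n a b : ℕ}
    (M : Matrix (Fin a) (Fin b) (MvPolynomial (Fin n) F)) : ℕ :=
  ⨆ p : Fin n → F, (M.map (eval p)).rank

end D1

section Tensor3

variable {F : Type*} [Field F]

/-- Substitute the first two blocks of variables of a trilinear form at `x` and `y`,
leaving a polynomial in the third block. -/
noncomputable def sub01 {n : ℕ} (T : MvPolynomial (Fin 3 × Fin n) F)
    (x y : Fin n → F) : MvPolynomial (Fin 3 × Fin n) F :=
  aeval (fun v : Fin 3 × Fin n =>
    if v.1 = 0 then C (x v.2) else if v.1 = 1 then C (y v.2) else X v) T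

open Classical in
/-- The bias of a 3-tensor: the probability over `(x, y)` that `T(x, y, -)` is the
zero linear form. -/
noncomputable def bias {n : ℕ} [Fintype F] (T : MvPolynomial (Fin 3 × Fin n) F) : ℝ :=
  ((Finset.univ.filter fun p : (Fin n → F) × (Fin n → F) =>
      sub01 T p.1 p.2 = 0).card : ℝ) /
    ((Fintype.card ((Fin n → F) × (Fin n → F))) : ℝ)

/-- The analytic rank of a 3-tensor. -/
noncomputable def AR {n : ℕ} [Fintype F] (T : MvPolynomial (Fin 3 × Fin n) F) : ℝ :=
  - Real.logb (Fintype.card F) (bias T)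

/-- A slice-rank decomposition: `T = ∑ f_t g_t` with `f_t` a linear form in one
block and `g_t` a bilinear form in the other two blocks. -/
def HasSRDecomp {n : ℕ} (T : MvPolynomial (Fin 3 × Fin n) F) (r : ℕ) : Prop :=
  ∃ (c : Fin r → Fin 3) (f g : Fin r → MvPolynomial (Fin 3 × Fin n) F),
    (∀ t, IsMultilinearOn {c t} (f t)) ∧
    (∀ t, IsMultilinearOn ({c t} : Finset (Fin 3))ᶜ (g t)) ∧
    T = ∑ t, f t * g t

/-- Slice rank of a 3-tensor. -/
noncomputable def SR {n : ℕ} (T : MvPolynomial (Fin 3 × Fin n) F) : ℕ :=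
  sInf {r | HasSRDecomp T r}

/-- The matrix `mat T` of a 3-tensor, evaluated at `x` in its first block:
the `(j,k)` entry is `T(x, e_j, e_k)`. -/
noncomputable def matT {n : ℕ} (T : MvPolynomial (Fin 3 × Fin n) F)
    (x : Fin n → F) : Matrix (Fin n) (Fin n) F :=
  Matrix.of fun j k => eval (fun v : Fin 3 × Fin n =>
    if v.1 = 0 then x v.2
    else if v.1 = 1 then (if v.2 = j then 1 else 0)
    else (if v.2 = k then 1 else 0)) T

end Tensor3

section Mult

variable {F : Type*} [Field F]

/-- `mult(f, p)`: the minimum total degree of a monomial of `f(x + p)`. -/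
noncomputable def polyMult {n : ℕ} (f : MvPolynomial (Fin n) F) (p : Fin n → F) : ℕ :=
  sInf {k | ∃ m ∈ (aeval (fun i : Fin n => X i + C (p i)) f :
    MvPolynomial (Fin n) F).support, (∑ i, m i) = k}

end Mult

section Core

variable {F K E : Type*} [Field F] [Fintype F] [Field K] [Algebra F K]
  [AddCommGroup E] [Module K E] {m : ℕ}

/-- new coordinates -/
noncomputable def yC (v : Fin (m+1) → K) (p : Fin (m+1) → F) (i : Fin (m+1)) : K :=
  Fin.cases ((v 0)⁻¹ * algebraMap F K (p 0))
    (fun j => algebraMap F K (p j.succ) - v j.succ * ((v 0)⁻¹ * algebraMap F K (p 0))) i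

noncomputable def genL (T : Fin (m+1) → E →ₗ[K] E) (p : Fin (m+1) → F) : E →ₗ[K] E :=
  ∑ i, algebraMap F K (p i) • T i

noncomputable def lowMap (v : Fin (m+1) → K) :
    ((Fin m → Fin (Fintype.card F)) → E) →ₗ[K] ((Fin (m+1) → F) → E) :=
  LinearMap.pi fun p => ∑ α : Fin m → Fin (Fintype.card F),
    (∏ j, yC v p j.succ ^ (α j : ℕ)) • LinearMap.proj α

noncomputable def imMap (T : Fin (m+1) → E →ₗ[K] E) :
    (∀ p : Fin (m+1) → F, LinearMap.range (genL T p)) →ₗ[K] ((Fin (m+1) → F) → E) :=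
  LinearMap.pi fun p => (Submodule.subtype _) ∘ₗ LinearMap.proj p

lemma genL_eq (T : Fin (m+1) → E →ₗ[K] E) (v : Fin (m+1) → K) (hv : v 0 ≠ 0)
    (hT : ∑ i, v i • T i = LinearMap.id) (p : Fin (m+1) → F) (e : E) :
    genL T p e = yC v p 0 • e + ∑ j : Fin m, yC v p j.succ • T j.succ e := by
  have h1 : e = ∑ i, v i • T i e := by
    have := congrArg (fun f : E →ₗ[K] E => f e) hT
    simpa using this.symm
  have h2 : yC v p 0 • e = ∑ i, (yC v p 0 * v i) • T i e := by
    conv_lhs => rw [h1, Finset.smul_sum]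
    simp [smul_smul]
  rw [h2]
  simp only [genL, LinearMap.sum_apply, LinearMap.smul_apply]
  rw [Fin.sum_univ_succ, Fin.sum_univ_succ, add_assoc, ← Finset.sum_add_distrib]
  congr 1
  · congr 1
    simp only [yC, Fin.cases_zero]
    field_simp
  · refine Finset.sum_congr rfl fun j _ => ?_
    rw [← add_smul]
    congr 1
    simp only [yC, Fin.cases_zero, Fin.cases_succ]
    ring

lemma yC_pow (v : Fin (m+1) → K) (hv : v 0 ≠ 0) (p : Fin (m+1) → F) (j : Fin m) :
    yC v p j.succ ^ Fintype.card F = yC v p j.succ +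
      (v j.succ - (v j.succ * (v 0)⁻¹) ^ Fintype.card F * v 0) * yC v p 0 := by
  have hq : ∀ a : F, (algebraMap F K a) ^ Fintype.card F = algebraMap F K a := by
    intro a; rw [← map_pow, FiniteField.pow_card]
  obtain ⟨c, hc⟩ := CharP.exists F
  have := hc
  obtain ⟨k, hp, hk⟩ := FiniteField.card F c
  have : Fact c.Prime := ⟨hp⟩
  have : CharP K c := charP_of_injective_algebraMap (algebraMap F K).injective c
  have hs : ∀ a b : K, (a - b) ^ Fintype.card F = a ^ Fintype.card F - b ^ Fintype.card F := by
    intro a b; rw [hk]; exact sub_pow_char_pow a b _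
  simp only [yC, Fin.cases_zero, Fin.cases_succ]
  rw [hs, hq, ← mul_assoc, mul_pow, hq]
  field_simp
  ring

lemma mono_mem (T : Fin (m+1) → E →ₗ[K] E) (v : Fin (m+1) → K) (hv : v 0 ≠ 0)
    (hT : ∑ i, v i • T i = LinearMap.id) :
    ∀ (D k : ℕ) (β : Fin m → ℕ) (_ : k + ∑ j, β j = D) (e : E),
      (fun p : Fin (m+1) → F => (yC v p 0 ^ k * ∏ j, yC v p j.succ ^ β j) • e) ∈
        LinearMap.range (lowMap (F := F) (E := E) v) ⊔ LinearMap.range (imMap (F := F) T) := by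
  intro D
  induction D using Nat.strong_induction_on with
  | _ D ihD =>
  intro k
  induction k with
  | zero =>
    intro β hβ e
    by_cases hlt : ∀ j, β j < Fintype.card F
    · apply Submodule.mem_sup_left
      refine ⟨Pi.single (fun j => ⟨β j, hlt j⟩) e, ?_⟩
      ext p
      simp only [lowMap, LinearMap.pi_apply, LinearMap.sum_apply, LinearMap.smul_apply,
        LinearMap.proj_apply]
      rw [Finset.sum_eq_single (fun j => ⟨β j, hlt j⟩)]
      · simp
      · intro b _ hb
        simp [Pi.single_eq_of_ne hb]
      · simp
    · push Not at hlt
      obtain ⟨j, hj⟩ := hlt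
      have hq : 1 < Fintype.card F := Fintype.one_lt_card
      set q := Fintype.card F with hqdef
      have hsum : ∀ x, ∑ i, Function.update β j x i + β j = x + ∑ i, β i := by
        intro x
        rw [Finset.sum_update_of_mem (Finset.mem_univ _),
          ← Finset.add_sum_erase Finset.univ β (Finset.mem_univ j), Finset.sdiff_singleton_eq_erase]
        ring
      have hprod : ∀ (x : ℕ) (p : Fin (m+1) → F), ∏ i, yC v p i.succ ^ (Function.update β j x i) =
          yC v p j.succ ^ x * ∏ i ∈ Finset.univ.erase j, yC v p i.succ ^ β i := by
        intro x p
        rw [← Finset.mul_prod_erase Finset.univ _ (Finset.mem_univ j)]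
        congr 1
        · simp
        · refine Finset.prod_congr rfl fun i hi => ?_
          rw [Function.update_of_ne (Finset.ne_of_mem_erase hi)]
      have h1 := ihD _ (by have := hsum (β j - q + 1); omega) 0
        (Function.update β j (β j - q + 1)) rfl e
      have h2 := ihD _ (by have := hsum (β j - q); omega) 1
        (Function.update β j (β j - q)) rfl e
      have h3 := Submodule.add_mem _ h1 (Submodule.smul_mem _
        (v j.succ - (v j.succ * (v 0)⁻¹) ^ q * v 0) h2)
      convert h3 using 1
      ext p
      simp only [Pi.add_apply, Pi.smul_apply, smul_smul, ← add_smul, hprod]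
      congr 1
      rw [← Finset.mul_prod_erase Finset.univ _ (Finset.mem_univ j)]
      have : yC v p j.succ ^ β j = yC v p j.succ ^ (β j - q) * yC v p j.succ ^ q := by
        rw [← pow_add]; congr 1; omega
      rw [this, yC_pow v hv]
      ring
  | succ k ihk =>
    intro β hβ e
    have hN : (fun p : Fin (m+1) → F =>
        genL T p ((yC v p 0 ^ k * ∏ j, yC v p j.succ ^ β j) • e)) ∈
        LinearMap.range (lowMap (F := F) (E := E) v) ⊔ LinearMap.range (imMap (F := F) T) := by
      apply Submodule.mem_sup_right
      exact ⟨fun p => ⟨_, ⟨(yC v p 0 ^ k * ∏ j, yC v p j.succ ^ β j) • e, rfl⟩⟩, rfl⟩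
    have hS : ∀ j : Fin m, _ := fun j => ihk (β + Pi.single j 1) (by
      simp [Finset.sum_add_distrib]; omega) (T j.succ e)
    have h3 := Submodule.sub_mem _ hN (Submodule.sum_mem _ fun j (_ : j ∈ Finset.univ) => hS j)
    convert h3 using 1
    ext p
    simp only [Pi.sub_apply, Finset.sum_apply]
    rw [genL_eq T v hv hT, add_sub_assoc, ← Finset.sum_sub_distrib, Finset.sum_eq_zero, add_zero,
      smul_smul]
    · congr 1; ring
    · intro j _
      rw [map_smul, smul_smul, sub_eq_zero]
      congr 1
      have : ∏ i : Fin m, yC v p i.succ ^ ((β + Pi.single j 1 : Fin m → ℕ) i) =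
          (∏ i, yC v p i.succ ^ β i) * yC v p j.succ := by
        simp only [Pi.add_apply, pow_add, Finset.prod_mul_distrib]
        congr 1
        rw [Finset.prod_eq_single j]
        · simp
        · intro b _ hb; simp [Pi.single_eq_of_ne hb]
        · simp
      rw [this]
      ring

lemma poly_mem (T : Fin (m+1) → E →ₗ[K] E) (v : Fin (m+1) → K) (hv : v 0 ≠ 0)
    (hT : ∑ i, v i • T i = LinearMap.id) (g : MvPolynomial (Fin (m+1)) K) (e : E) :
      (fun p : Fin (m+1) → F => (eval (yC v p) g) • e) ∈
        LinearMap.range (lowMap (F := F) (E := E) v) ⊔ LinearMap.range (imMap (F := F) T) := by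
  induction g using MvPolynomial.induction_on' with
  | monomial u a =>
    have h := Submodule.smul_mem _ a
      (mono_mem (F := F) T v hv hT _ (u 0) (fun j => u j.succ) rfl e)
    convert h using 1
    ext p
    simp only [Pi.smul_apply, smul_smul]
    rw [eval_monomial, Finsupp.prod_fintype _ _ (by simp), Fin.prod_univ_succ]
  | add f g hf hg =>
    convert Submodule.add_mem _ hf hg using 1
    ext p
    simp [add_smul]

lemma top_le (T : Fin (m+1) → E →ₗ[K] E) (v : Fin (m+1) → K) (hv : v 0 ≠ 0)
    (hT : ∑ i, v i • T i = LinearMap.id) :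
    LinearMap.range (lowMap (F := F) (E := E) v) ⊔ LinearMap.range (imMap (F := F) T) = ⊤ := by
  classical
  rw [eq_top_iff]
  intro h _
  have hh : h = ∑ a, Pi.single a (h a) := by
    ext p; simp [Finset.sum_apply, Pi.single_apply]
  rw [hh]
  refine Submodule.sum_mem _ fun a _ => ?_
  let g : MvPolynomial (Fin (m+1)) K := aeval (Fin.cases (C (v 0) * X 0)
    (fun j => X j.succ + C (v j.succ) * X 0) : Fin (m+1) → MvPolynomial (Fin (m+1)) K)
    (MvPolynomial.indicator a)
  have := poly_mem (F := F) T v hv hT g (h a)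
  convert this using 1
  ext p
  have key : eval (yC v p) g = algebraMap F K (eval p (MvPolynomial.indicator a)) := by
    have e1 : (((aeval (yC v p) : MvPolynomial (Fin (m+1)) K →ₐ[K] K).restrictScalars F).comp
      (aeval (Fin.cases (C (v 0) * X 0)
    (fun j => X j.succ + C (v j.succ) * X 0) : Fin (m+1) → MvPolynomial (Fin (m+1)) K)))
      = (Algebra.ofId F K).comp (aeval p) := by
      apply MvPolynomial.algHom_ext
      intro i
      refine Fin.cases ?_ (fun j => ?_) i
      · simp [yC, Algebra.ofId_apply, hv]
      · simp [yC, Algebra.ofId_apply]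
    have := congrArg (fun f => f (MvPolynomial.indicator a)) e1
    simpa [Algebra.ofId_apply, g, aeval_eq_eval] using this
  rw [key]
  by_cases hp : p = a
  · subst hp; simp [eval_indicator_apply_eq_one]
  · rw [eval_indicator_apply_eq_zero _ _ hp]; simp [hp]

lemma core [FiniteDimensional K E] (T : Fin (m+1) → E →ₗ[K] E) (v : Fin (m+1) → K) (hv : v 0 ≠ 0)
    (hT : ∑ i, v i • T i = LinearMap.id) :
    Fintype.card F ^ (m+1) * Module.finrank K E ≤
      Fintype.card F ^ m * Module.finrank K E +
      ∑ p : Fin (m+1) → F, Module.finrank K (LinearMap.range (genL T p)) := by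
  have h := Submodule.finrank_add_le_finrank_add_finrank
    (LinearMap.range (lowMap (F := F) (E := E) v)) (LinearMap.range (imMap (F := F) T))
  rw [top_le T v hv hT, finrank_top, Module.finrank_pi_fintype] at h
  have h1 := LinearMap.finrank_range_le (lowMap (F := F) (E := E) v)
  have h2 := LinearMap.finrank_range_le (imMap (F := F) T)
  rw [Module.finrank_pi_fintype] at h1 h2
  simp only [Finset.sum_const, Finset.card_univ, Fintype.card_pi, Finset.prod_const, Fintype.card_fin,
    smul_eq_mul] at h h1
  omega

/-- rectangular version -/
lemma core' {X Y : Type*} [AddCommGroup X] [Module K X] [AddCommGroup Y] [Module K Y]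
    [FiniteDimensional K X] [FiniteDimensional K Y]
    (T : Fin (m+1) → X →ₗ[K] Y) (v : Fin (m+1) → K) (hv : v 0 ≠ 0) :
    Fintype.card F ^ (m+1) * Module.finrank K (LinearMap.range (∑ i, v i • T i)) ≤
      Fintype.card F ^ m * Module.finrank K (LinearMap.range (∑ i, v i • T i)) +
      ∑ p : Fin (m+1) → F,
        Module.finrank K (LinearMap.range (∑ i, algebraMap F K (p i) • T i)) := by
  set L := ∑ i, v i • T i with hL
  obtain ⟨s, hs⟩ := L.rangeRestrict.exists_rightInverse_of_surjective L.range_rangeRestrict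
  obtain ⟨P, hP⟩ := (LinearMap.range L).subtype.exists_leftInverse_of_injective
    (Submodule.ker_subtype _)
  have hcomp : ∀ c : Fin (m+1) → K, ∑ i, c i • (P ∘ₗ T i ∘ₗ s) = P ∘ₗ (∑ i, c i • T i) ∘ₗ s := by
    intro c
    ext x
    simp
  have h := core (F := F) (fun i => P ∘ₗ T i ∘ₗ s) v hv (by
    rw [hcomp, ← hL]
    have h1 : P ∘ₗ L ∘ₗ s =
        (P ∘ₗ (LinearMap.range L).subtype) ∘ₗ (L.rangeRestrict ∘ₗ s) := rfl
    rw [h1, hs, hP, LinearMap.comp_id])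
  refine h.trans (Nat.add_le_add_left (Finset.sum_le_sum fun p _ => ?_) _)
  rw [genL, hcomp (fun i => algebraMap F K (p i)), LinearMap.range_comp]
  refine (Submodule.finrank_map_le _ _).trans ?_
  exact Submodule.finrank_mono (LinearMap.range_comp_le_range _ _)

end Core

section Expand

variable {F : Type*} [Field F] {d n : ℕ}

noncomputable def subLast (u : Fin n → MvPolynomial (Fin (d+1) × Fin n) F)
    (v : Fin (d+1) × Fin n) : MvPolynomial (Fin (d+1) × Fin n) F :=
  if v.1 = Fin.last d then u v.2 else X v

lemma expand_aux (f : MvPolynomial (Fin (d+1) × Fin n) F) (hf : IsMultilinear f)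
    (u : Fin n → MvPolynomial (Fin (d+1) × Fin n) F) :
    aeval (subLast u) f = ∑ j, u j * aeval (subLast (Pi.single j 1)) f := by
  have hmon : ∀ w : Fin n → MvPolynomial (Fin (d+1) × Fin n) F, aeval (subLast w) f =
      ∑ m ∈ f.support, (C (coeff m f) * ∏ i : Fin d, ∏ j, X (i.castSucc, j) ^ m (i.castSucc, j)) *
        ∏ j, w j ^ m (Fin.last d, j) := by
    intro w
    conv_lhs => rw [f.as_sum]
    rw [map_sum]
    refine Finset.sum_congr rfl fun m _ => ?_
    rw [aeval_monomial, Finsupp.prod_fintype _ _ (by simp), Fintype.prod_prod_type,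
      Fin.prod_univ_castSucc, ← mul_assoc]
    simp [subLast, Fin.castSucc_ne_last, algebraMap_eq]
  simp_rw [hmon, Finset.mul_sum]
  rw [Finset.sum_comm]
  refine Finset.sum_congr rfl fun m hm => ?_
  have h1 : ∑ j, m (Fin.last d, j) = 1 := by simpa using hf m hm (Fin.last d)
  obtain ⟨j0, hj0⟩ : ∃ j0, ∀ j, m (Fin.last d, j) = if j = j0 then 1 else 0 := by
    obtain ⟨j0, -, hj⟩ : ∃ j ∈ Finset.univ, m (Fin.last d, j) ≠ 0 := by
      apply Finset.exists_ne_zero_of_sum_ne_zero; rw [h1]; simp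
    refine ⟨j0, fun j => ?_⟩
    rw [← Finset.add_sum_erase _ _ (Finset.mem_univ j0)] at h1
    split_ifs with h
    · subst h; omega
    · have := Finset.single_le_sum (f := fun j => m (Fin.last d, j)) (fun _ _ => Nat.zero_le _)
        (Finset.mem_erase.2 ⟨h, Finset.mem_univ j⟩)
      omega
  have hw : ∀ w : Fin n → MvPolynomial (Fin (d+1) × Fin n) F,
      ∏ j, w j ^ m (Fin.last d, j) = w j0 := by
    intro w
    simp [hj0]
  simp_rw [hw]
  rw [Finset.sum_eq_single j0]
  · simp; ring
  · intro b _ hb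
    rw [Pi.single_eq_of_ne hb.symm]; simp
  · simp

end Expand

/-- Over `F_q` and for `d ≥ 1` blocks (here `d + 1` blocks),
`E_{p_d}[CR(M[p_d])] ≥ (1 − 1/q) · CR(M)`, where `M[p_d]` substitutes the last
block of variables. -/
theorem statement_4 (F : Type*) [Field F] [Fintype F] (d n a b : ℕ) (hn : 1 ≤ n)
    (M : Matrix (Fin a) (Fin b) (MvPolynomial (Fin (d + 1) × Fin n) F))
    (hM : ∀ i j, IsMultilinear (M i j)) :
    (1 - 1 / (Fintype.card F : ℝ)) * (CR M : ℝ) ≤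
      (∑ p : Fin n → F, (CR (pevalMat M {Fin.last d} (fun _ => p)) : ℝ)) /
        (Fintype.card (Fin n → F) : ℝ) := by
  obtain ⟨m, rfl⟩ : ∃ m, n = m + 1 := ⟨n - 1, by omega⟩
  let R := MvPolynomial (Fin (d + 1) × Fin (m+1)) F
  let K := FractionRing R
  let A : Fin (m+1) → Matrix (Fin a) (Fin b) K := fun j =>
    M.map fun f => algebraMap R K (aeval (subLast (Pi.single j 1)) f)
  let v : Fin (m+1) → K := fun j => algebraMap R K (X (Fin.last d, j))
  have hv : v 0 ≠ 0 := by
    intro h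
    have h' : algebraMap R K (X (Fin.last d, 0)) = algebraMap R K 0 := by rw [map_zero]; exact h
    exact X_ne_zero (R := F) _ (IsFractionRing.injective R K h')
  have h := core' (F := F) (fun j => (A j).mulVecLin) v hv
  have hlin : ∀ c : Fin (m+1) → K, ∑ j, c j • (A j).mulVecLin = (∑ j, c j • A j).mulVecLin := by
    intro c
    apply LinearMap.ext
    intro x
    simp [Matrix.sum_mulVec, Matrix.smul_mulVec]
  have hE : ∀ u : Fin (m+1) → R, (M.map fun f => algebraMap R K (aeval (subLast u) f)) =
      ∑ j, algebraMap R K (u j) • A j := by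
    intro u
    ext i k
    simp only [Matrix.map_apply, Matrix.sum_apply, Matrix.smul_apply, A, smul_eq_mul]
    rw [expand_aux _ (hM i k) u, map_sum]
    simp only [map_mul]
  have hCR : Module.finrank K (LinearMap.range (∑ i, v i • (A i).mulVecLin)) = CR M := by
    rw [hlin, ← hE (fun j => X (Fin.last d, j)), CR, Matrix.rank]
    have : (subLast fun j => X (Fin.last d, j) :
        Fin (d+1) × Fin (m+1) → MvPolynomial (Fin (d+1) × Fin (m+1)) F) = X := by
      ext1 ⟨i, j⟩
      simp only [subLast]
      split_ifs with h
      · rw [h]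
      · rfl
    rw [this]
    have e : (fun f : R => algebraMap R K (aeval X f)) = algebraMap R K := by
      funext f
      exact congrArg _ (aeval_X_left_apply f)
    rw [e]
  have hCRp : ∀ p : Fin (m+1) → F, Module.finrank K
      (LinearMap.range (∑ i, algebraMap F K (p i) • (A i).mulVecLin)) =
      CR (pevalMat M {Fin.last d} (fun _ => p)) := by
    intro p
    have h1 : ∀ i, algebraMap F K (p i) = algebraMap R K (C (p i)) := fun i =>
      IsScalarTower.algebraMap_apply F R K (p i)
    have h2 : ∑ i, algebraMap F K (p i) • (A i).mulVecLin =
        ∑ i, algebraMap R K (C (p i)) • (A i).mulVecLin :=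
      Finset.sum_congr rfl fun i _ => congrArg (fun t : K => t • (A i).mulVecLin) (h1 i)
    rw [h2, hlin (fun i => algebraMap R K (C (p i))), ← hE (fun j => C (p j)), CR, Matrix.rank, pevalMat]
    have : (fun v : Fin (d+1) × Fin (m+1) => if v.1 ∈ ({Fin.last d} : Finset _) then
        (C (p v.2) : MvPolynomial (Fin (d+1) × Fin (m+1)) F) else X v) =
        subLast (fun j => C (p j)) := by
      ext1 w; simp [subLast]
    rw [this, Matrix.map_map]
    rfl
  rw [hCR] at h
  simp only [hCRp] at h
  have hq : (0:ℝ) < Fintype.card F := by exact_mod_cast Fintype.card_pos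
  have h' : (Fintype.card F : ℝ) ^ (m+1) * CR M ≤ (Fintype.card F : ℝ) ^ m * CR M +
      ∑ p : Fin (m+1) → F, (CR (pevalMat M {Fin.last d} (fun _ => p)) : ℝ) := by
    exact_mod_cast h
  rw [le_div_iff₀ (by exact_mod_cast Fintype.card_pos)]
  simp only [Fintype.card_pi, Finset.prod_const, Finset.card_univ, Fintype.card_fin]
  push_cast
  have : (1 - 1 / (Fintype.card F : ℝ)) * (CR M : ℝ) * (Fintype.card F : ℝ) ^ (m+1) =
    (Fintype.card F : ℝ) ^ (m+1) * CR M - (Fintype.card F : ℝ) ^ m * CR M := by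
    rw [pow_succ]; field_simp
  rw [this]
  linarith
end

section
/- For any field F and any M_1-matrix M (a matrix of homogeneous linear forms), PR(M) ≤ 2 · CR(M). -/
open MvPolynomial

lemma aux_cols {K : Type*} [Field K] {a b r : ℕ} (M : Matrix (Fin a) (Fin b) K)
    (h : M.rank = r) : ∃ J : Fin r → Fin b, (M.submatrix id J).rank = r := by
  subst h
  rw [Matrix.rank_eq_finrank_span_cols]
  obtain ⟨f, hf, hspan, -⟩ := Submodule.exists_fun_fin_finrank_span_eq K (Set.range M.col)
  choose J hJ using hf
  refine ⟨J, ?_⟩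
  rw [Matrix.rank_eq_finrank_span_cols]
  refine Eq.trans ?_ (congrArg (fun N : Submodule K (Fin a → K) => Module.finrank K N) hspan)
  have hr : Set.range (M.submatrix id J).col = Set.range f := ?_
  · rw [hr]
  ext x
  constructor
  · rintro ⟨i, rfl⟩
    exact ⟨i, by rw [← hJ i]; rfl⟩
  · rintro ⟨i, rfl⟩
    exact ⟨i, by rw [← hJ i]; rfl⟩

lemma aux_minor {K : Type*} [Field K] {a b r : ℕ} (M : Matrix (Fin a) (Fin b) K)
    (h : M.rank = r) : ∃ (I : Fin r → Fin a) (J : Fin r → Fin b),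
      (M.submatrix I J).det ≠ 0 := by
  obtain ⟨J, hJ⟩ := aux_cols M h
  obtain ⟨I, hI⟩ := aux_cols (M.submatrix id J).transpose (by rw [Matrix.rank_transpose, hJ])
  refine ⟨I, J, ?_⟩
  have h2 : (M.submatrix I J).rank = r := by
    rw [← Matrix.rank_transpose]; exact hI
  intro h0
  obtain ⟨v, hv, hv0⟩ := Matrix.exists_mulVec_eq_zero_iff.mpr h0
  have h3 := LinearMap.finrank_range_add_finrank_ker (M.submatrix I J).mulVecLin
  have h4 : Module.finrank K (LinearMap.range (M.submatrix I J).mulVecLin) = r := h2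
  rw [h4, Module.finrank_fin_fun] at h3
  have h5 : Module.finrank K (LinearMap.ker (M.submatrix I J).mulVecLin) = 0 := by omega
  rw [Submodule.finrank_eq_zero] at h5
  have : v ∈ LinearMap.ker (M.submatrix I J).mulVecLin := by simpa using hv0
  rw [h5] at this
  exact hv (by simpa using this)

lemma aux_schur {K : Type*} [Field K] {a b r : ℕ} (M : Matrix (Fin a) (Fin b) K)
    (h : M.rank = r) (I : Fin r → Fin a) (J : Fin r → Fin b)
    (hd : (M.submatrix I J).det ≠ 0) :
    (M.submatrix I J).det • M =
      M.submatrix id J * (M.submatrix I J).adjugate * M.submatrix I id := by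
  have hS : (M.submatrix I J).rank = r := by
    rw [Matrix.rank_of_det_ne_zero hd]; simp
  have hJ : (M.submatrix id J).rank = r := by
    apply le_antisymm
    · have := Matrix.rank_le_width (M.submatrix id J); exact this
    · exact hS.symm.le.trans (Matrix.rank_submatrix_le (M.submatrix id J) I id)
  have hle : LinearMap.range (M.submatrix id J).mulVecLin ≤ LinearMap.range M.mulVecLin := by
    rw [Matrix.range_mulVecLin, Matrix.range_mulVecLin]
    apply Submodule.span_mono
    rintro _ ⟨i, rfl⟩
    exact ⟨J i, rfl⟩
  have heq := Submodule.eq_of_le_of_finrank_eq hle (hJ.trans h.symm)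
  have hx : ∀ k : Fin b, ∃ x : Fin r → K, (M.submatrix id J).mulVec x = M.col k := by
    intro k
    have : M.col k ∈ LinearMap.range (M.submatrix id J).mulVecLin := by
      rw [heq, Matrix.range_mulVecLin]
      exact Submodule.subset_span ⟨k, rfl⟩
    exact this
  choose x hx using hx
  have hM : M = M.submatrix id J * (Matrix.of x).transpose := by
    ext i k
    exact (congrFun (hx k) i).symm
  have hMI : M.submatrix I id = M.submatrix I J * (Matrix.of x).transpose := by
    ext i k
    exact (congrFun (hx k) (I i)).symm
  rw [hMI, Matrix.mul_assoc, ← Matrix.mul_assoc (Matrix.adjugate _), Matrix.adjugate_mul,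
    Matrix.smul_mul, Matrix.one_mul, Matrix.mul_smul, ← hM]

lemma aux_schur_poly {F : Type*} [Field F] {n a b r : ℕ}
    (M : Matrix (Fin a) (Fin b) (MvPolynomial (Fin n) F))
    (h : CR M = r) (I : Fin r → Fin a) (J : Fin r → Fin b)
    (hd : (M.submatrix I J).det ≠ 0) :
    (M.submatrix I J).det • M =
      M.submatrix id J * (M.submatrix I J).adjugate * M.submatrix I id := by
  set f := algebraMap (MvPolynomial (Fin n) F) (FractionRing (MvPolynomial (Fin n) F)) with hf
  have inj : Function.Injective f := IsFractionRing.injective _ _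
  have hdet : ((M.map f).submatrix I J).det = f (M.submatrix I J).det := by
    rw [RingHom.map_det]; rfl
  have key := aux_schur (M.map f) h I J (by
    rw [hdet]; exact fun h0 => hd (inj (by rw [h0, map_zero])))
  have hadj : ((M.map f).submatrix I J).adjugate = (M.submatrix I J).adjugate.map f := by
    have := RingHom.map_adjugate f (M.submatrix I J)
    exact this.symm
  rw [hdet, hadj] at key
  apply Matrix.map_injective inj
  simp only [Matrix.map_mul]
  rw [show (M.submatrix id J).map f = (M.map f).submatrix id J from rfl,
    show (M.submatrix I id).map f = (M.map f).submatrix I id from rfl, ← key]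
  ext i j
  simp

lemma aux_minor_poly {F : Type*} [Field F] {n a b r : ℕ}
    (M : Matrix (Fin a) (Fin b) (MvPolynomial (Fin n) F))
    (h : CR M = r) : ∃ (I : Fin r → Fin a) (J : Fin r → Fin b),
      (M.submatrix I J).det ≠ 0 := by
  obtain ⟨I, J, hIJ⟩ := aux_minor _ h
  refine ⟨I, J, fun h0 => hIJ ?_⟩
  have := RingHom.map_det (algebraMap (MvPolynomial (Fin n) F)
    (FractionRing (MvPolynomial (Fin n) F))) (M.submatrix I J)
  rw [h0, map_zero] at this
  exact this.symm

/-- a nonzero minor whose degree is maximal among all minors of its size -/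
lemma aux_max_minor {F : Type*} [Field F] {n a b r : ℕ}
    (m : MonomialOrder (Fin n))
    (M : Matrix (Fin a) (Fin b) (MvPolynomial (Fin n) F))
    (h : CR M = r) : ∃ (I : Fin r → Fin a) (J : Fin r → Fin b),
      (M.submatrix I J).det ≠ 0 ∧ ∀ (I' : Fin r → Fin a) (J' : Fin r → Fin b), m.toSyn (m.degree (M.submatrix I' J').det) ≤
        m.toSyn (m.degree (M.submatrix I J).det) := by
  classical
  obtain ⟨I₀, J₀, h₀⟩ := aux_minor_poly M h
  let s : Finset ((Fin r → Fin a) × (Fin r → Fin b)) :=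
    Finset.univ.filter fun p => (M.submatrix p.1 p.2).det ≠ 0
  obtain ⟨p, hp, hmax⟩ := Finset.exists_max_image s
    (fun p => m.toSyn (m.degree (M.submatrix p.1 p.2).det)) ⟨(I₀, J₀), by simp [s, h₀]⟩
  refine ⟨p.1, p.2, by simpa [s] using hp, fun I' J' => ?_⟩
  by_cases h1 : (M.submatrix I' J').det = 0
  · rw [h1, MonomialOrder.degree_zero, map_zero]
    exact m.zero_le _
  · exact hmax (I', J') (by simp [s, h1])

lemma aux_cramer_col {R : Type*} [CommRing R] {a b r : ℕ} (M : Matrix (Fin a) (Fin b) R)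
    (I : Fin r → Fin a) (J : Fin r → Fin b) (s : Fin r) (k : Fin b) :
    ((M.submatrix I J).adjugate * M.submatrix I id) s k =
      (M.submatrix I (Function.update J s k)).det := by
  have : ((M.submatrix I J).adjugate * M.submatrix I id) s k =
    ((M.submatrix I J).adjugate.mulVec fun i => M (I i) k) s := rfl
  rw [this, ← Matrix.cramer_eq_adjugate_mulVec, Matrix.cramer_apply]
  congr 1
  ext i j
  by_cases hj : j = s
  · subst hj; simp
  · simp [hj]

lemma aux_cramer_row {R : Type*} [CommRing R] {a b r : ℕ} (M : Matrix (Fin a) (Fin b) R)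
    (I : Fin r → Fin a) (J : Fin r → Fin b) (s : Fin r) (l : Fin a) :
    (M.submatrix id J * (M.submatrix I J).adjugate) l s =
      (M.submatrix (Function.update I s l) J).det := by
  have h := aux_cramer_col M.transpose J I s l
  rw [← Matrix.det_transpose (M.submatrix (Function.update I s l) J), Matrix.transpose_submatrix,
    ← h, ← Matrix.transpose_submatrix, ← Matrix.transpose_submatrix, ← Matrix.adjugate_transpose,
    ← Matrix.transpose_mul, Matrix.transpose_apply]

/-- differentiate `A v = 0`, hit with `u` -/
lemma aux_deriv {F : Type*} [Field F] {n a b : ℕ}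
    (M : Matrix (Fin a) (Fin b) (MvPolynomial (Fin n) F))
    (P : Matrix (Fin a) (Fin a) (MvPolynomial (Fin n) F))
    (Q : Matrix (Fin b) (Fin b) (MvPolynomial (Fin n) F))
    (hP : P * M = 0) (hQ : M * Q = 0) (t : Fin n) :
    P * M.map (pderiv (R := F) t) * Q = 0 := by
  have h1 : M.map (pderiv (R := F) t) * Q + M * Q.map (pderiv (R := F) t) = 0 := by
    refine Matrix.ext fun i j => ?_
    have := congrArg (pderiv (R := F) t) (congrFun (congrFun hQ i) j)
    simp only [Matrix.mul_apply, map_sum, Derivation.leibniz, Matrix.zero_apply, map_zero,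
      smul_eq_mul, Finset.sum_add_distrib] at this
    simp only [Matrix.add_apply, Matrix.mul_apply, Matrix.map_apply, Matrix.zero_apply]
    rw [← this, add_comm]
    congr 1
    exact Finset.sum_congr rfl fun x _ => mul_comm (pderiv (R := F) t (M i x)) (Q x j)
  have h2 : P * (M.map (pderiv (R := F) t) * Q + M * Q.map (pderiv (R := F) t)) = 0 := by
    rw [h1, Matrix.mul_zero]
  rwa [Matrix.mul_add, ← Matrix.mul_assoc P M, hP, Matrix.zero_mul, add_zero,
    ← Matrix.mul_assoc] at h2

lemma aux_top {F : Type*} [Field F] {n a b : ℕ} (m : MonomialOrder (Fin n)) (D : Fin n →₀ ℕ)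
    (M : Matrix (Fin a) (Fin b) (MvPolynomial (Fin n) F))
    (hM : ∀ i j, (M i j).IsHomogeneous 1)
    (P : Matrix (Fin a) (Fin a) (MvPolynomial (Fin n) F))
    (Q : Matrix (Fin b) (Fin b) (MvPolynomial (Fin n) F))
    (hP : P * M = 0) (hQ : M * Q = 0)
    (hPD : ∀ i j, m.toSyn (m.degree (P i j)) ≤ m.toSyn D)
    (hQD : ∀ i j, m.toSyn (m.degree (Q i j)) ≤ m.toSyn D) :
    P.map (fun p => (C (coeff D p) : MvPolynomial (Fin n) F)) * M *
      Q.map (fun p => (C (coeff D p) : MvPolynomial (Fin n) F)) = 0 := by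
  have hc : ∀ t i j, pderiv t (M i j) = C (coeff 0 (pderiv t (M i j))) := by
    intro t i j
    have := (hM i j).pderiv (i := t)
    exact MvPolynomial.totalDegree_eq_zero_iff_eq_C.mp
      (Nat.le_zero.mp (by simpa using this.totalDegree_le))
  have hE : ∀ i j, M i j = ∑ t, X t * C (coeff 0 (pderiv t (M i j))) := by
    intro i j
    have := (hM i j).sum_X_mul_pderiv
    rw [one_smul] at this
    rw [← this]
    conv_rhs => rw [this]
    exact Finset.sum_congr rfl fun t _ => by rw [← hc]
  have hz : ∀ t i j, ∑ l, (∑ k, coeff D (P i k) * coeff 0 (pderiv t (M k l))) * coeff D (Q l j)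
      = 0 := by
    intro t i j
    have h := congrArg (coeff (D + D)) (congrFun (congrFun (aux_deriv M P Q hP hQ t) i) j)
    simp only [Matrix.mul_apply, Matrix.map_apply, Matrix.zero_apply, coeff_zero, coeff_sum,
      Finset.sum_mul] at h
    simp only [Finset.sum_mul]
    rw [← h]
    refine Finset.sum_congr rfl fun l _ => Finset.sum_congr rfl fun k _ => ?_
    have e : P i k * pderiv (R := F) t (M k l) * Q l j =
        C (coeff 0 (pderiv (R := F) t (M k l))) * (P i k * Q l j) := by
      rw [← hc t k l]; ring
    rw [e, coeff_C_mul,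
      m.coeff_mul_of_add_of_degree_le (hPD i k) (hQD l j)]
    ring
  refine Matrix.ext fun i j => ?_
  simp only [Matrix.mul_apply, Matrix.map_apply, Matrix.zero_apply]
  have : ∑ l, (∑ k, C (coeff D (P i k)) * M k l) * C (coeff D (Q l j)) =
    ∑ t, X t * C (∑ l, (∑ k, coeff D (P i k) * coeff 0 (pderiv t (M k l))) * coeff D (Q l j)) := by
    simp only [map_sum, map_mul, Finset.mul_sum, Finset.sum_mul]
    rw [Finset.sum_comm]
    conv_rhs => rw [Finset.sum_comm]; enter [2, l]; rw [Finset.sum_comm]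
    rw [Finset.sum_comm]
    refine Finset.sum_congr rfl fun l _ => Finset.sum_congr rfl fun k _ => ?_
    conv_lhs => rw [hE k l]
    simp only [Finset.mul_sum, Finset.sum_mul]
    exact Finset.sum_congr rfl fun t _ => by ring
  rw [this]
  simp [hz]

/-- view a scalar matrix as a matrix of constant polynomials -/
noncomputable def cMat {F : Type*} [Field F] (n : ℕ) {p q : ℕ} (N : Matrix (Fin p) (Fin q) F) :
    Matrix (Fin p) (Fin q) (MvPolynomial (Fin n) F) := Matrix.of fun i j => C (N i j)

lemma aux_decomp {F : Type*} [Field F] {n a b r : ℕ}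
    (M : Matrix (Fin a) (Fin b) (MvPolynomial (Fin n) F))
    (G : Matrix (Fin a) (Fin r) F) (A : Matrix (Fin r) (Fin b) (MvPolynomial (Fin n) F))
    (B : Matrix (Fin a) (Fin r) (MvPolynomial (Fin n) F)) (H : Matrix (Fin r) (Fin b) F)
    (hA : ∀ i j, (A i j).IsHomogeneous 1) (hB : ∀ i j, (B i j).IsHomogeneous 1)
    (hM : M = cMat n G * A + B * cMat n H) : HasPR1Decomp M (r + r) := by
  refine ⟨Fin.append (fun _ => true) (fun _ => false),
    Fin.append (fun t i => C (G i t)) (fun t i => B i t),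
    Fin.append (fun t j => A t j) (fun t j => C (H t j)), ?_, ?_, ?_⟩
  · intro t i
    refine Fin.addCases (fun t => ?_) (fun t => ?_) t
    · simpa using isHomogeneous_C _ _
    · simpa only [Fin.append_right, Bool.false_eq_true, if_false] using hB i t
  · intro t i
    refine Fin.addCases (fun t => ?_) (fun t => ?_) t
    · simpa using hA t i
    · simpa only [Fin.append_right, Bool.false_eq_true, if_false] using isHomogeneous_C _ _
  · rw [hM, Fin.sum_univ_add]
    refine Matrix.ext fun i j => ?_
    simp only [Matrix.add_apply, Matrix.mul_apply, Matrix.sum_apply, Matrix.of_apply,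
      Fin.append_left, Fin.append_right, cMat]

theorem aux_main {F : Type*} [Field F] {n a b r : ℕ}
    (M : Matrix (Fin a) (Fin b) (MvPolynomial (Fin n) F))
    (hM : ∀ i j, (M i j).IsHomogeneous 1) (h : CR M = r) : HasPR1Decomp M (r + r) := by
  classical
  let m : MonomialOrder (Fin n) := MonomialOrder.lex
  obtain ⟨I, J, hd, hmax⟩ := aux_max_minor m M h
  have hs := aux_schur_poly M h I J hd
  set Δ := (M.submatrix I J).det with hΔ
  set S := M.submatrix I J with hS
  set D := m.degree Δ with hD
  let EI : Matrix (Fin r) (Fin a) (MvPolynomial (Fin n) F) := (1 : Matrix _ _ _).submatrix I id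
  let EJ : Matrix (Fin b) (Fin r) (MvPolynomial (Fin n) F) := (1 : Matrix _ _ _).submatrix id J
  have hEI : EI * M = M.submatrix I id := by
    refine Matrix.ext fun i j => ?_; simp [EI, Matrix.mul_apply, Matrix.one_apply]
  have hEJ : M * EJ = M.submatrix id J := by
    refine Matrix.ext fun i j => ?_; simp [EJ, Matrix.mul_apply, Matrix.one_apply]
  let Gp := M.submatrix id J * S.adjugate
  let Hp := S.adjugate * M.submatrix I id
  let P := Δ • (1 : Matrix (Fin a) (Fin a) (MvPolynomial (Fin n) F)) - Gp * EI
  let Q := Δ • (1 : Matrix (Fin b) (Fin b) (MvPolynomial (Fin n) F)) - EJ * Hp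
  have hP : P * M = 0 := by
    simp only [P, Gp]
    rw [Matrix.sub_mul, Matrix.smul_mul, Matrix.one_mul, Matrix.mul_assoc _ EI, hEI, hs, sub_self]
  have hQ : M * Q = 0 := by
    simp only [Q, Hp]
    rw [Matrix.mul_sub, Matrix.mul_smul, Matrix.mul_one, ← Matrix.mul_assoc, hEJ, hs,
      Matrix.mul_assoc, sub_self]
  have hdeg0 : ∀ f : MvPolynomial (Fin n) F, (∀ d, m.toSyn D < m.toSyn d → coeff d f = 0) →
      m.toSyn (m.degree f) ≤ m.toSyn D := by
    intro f hf
    rw [MonomialOrder.degree_le_iff]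
    intro c hc
    by_contra hlt
    exact (mem_support_iff.mp hc) (hf c (not_le.mp hlt))
  have hΔ0 : ∀ d, m.toSyn D < m.toSyn d → coeff d Δ = 0 := fun d hd =>
    m.coeff_eq_zero_of_lt hd
  have hG0 : ∀ i s d, m.toSyn D < m.toSyn d → coeff d (Gp i s) = 0 := fun i s d hd => by
    simp only [Gp]
    rw [hS, aux_cramer_row]
    exact m.coeff_eq_zero_of_lt (lt_of_le_of_lt (hmax _ _) hd)
  have hH0 : ∀ s i d, m.toSyn D < m.toSyn d → coeff d (Hp s i) = 0 := fun i s d hd => by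
    simp only [Hp]
    rw [hS, aux_cramer_col]
    exact m.coeff_eq_zero_of_lt (lt_of_le_of_lt (hmax _ _) hd)
  have hPc : ∀ i j d, coeff d (P i j) = coeff d Δ * (if i = j then 1 else 0) -
      ∑ s, coeff d (Gp i s) * (if I s = j then 1 else 0) := by
    intro i j d
    simp only [P, Matrix.sub_apply, Matrix.smul_apply, Matrix.one_apply, Matrix.mul_apply, EI,
      Matrix.submatrix_apply, id, coeff_sub, coeff_sum, smul_eq_mul]
    congr 1
    · split_ifs <;> simp
    · exact Finset.sum_congr rfl fun s _ => by split_ifs <;> simp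
  have hQc : ∀ i j d, coeff d (Q i j) = coeff d Δ * (if i = j then 1 else 0) -
      ∑ s, (if i = J s then 1 else 0) * coeff d (Hp s j) := by
    intro i j d
    simp only [Q, Matrix.sub_apply, Matrix.smul_apply, Matrix.one_apply, Matrix.mul_apply, EJ,
      Matrix.submatrix_apply, id, coeff_sub, coeff_sum, smul_eq_mul]
    congr 1
    · split_ifs <;> simp
    · exact Finset.sum_congr rfl fun s _ => by split_ifs <;> simp
  have hPD : ∀ i j, m.toSyn (m.degree (P i j)) ≤ m.toSyn D := fun i j => hdeg0 _ fun d hd => by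
    rw [hPc, hΔ0 d hd]; simp [hG0 _ _ d hd]
  have hQD : ∀ i j, m.toSyn (m.degree (Q i j)) ≤ m.toSyn D := fun i j => hdeg0 _ fun d hd => by
    rw [hQc, hΔ0 d hd]; simp [hH0 _ _ d hd]
  have key := aux_top m D M hM P Q hP hQ hPD hQD
  set δ := coeff D Δ with hδ
  have hδ0 : δ ≠ 0 := m.coeff_degree_ne_zero_iff.mpr hd
  let G0 : Matrix (Fin a) (Fin r) F := Gp.map (coeff D)
  let H0 : Matrix (Fin r) (Fin b) F := Hp.map (coeff D)
  set P0 := P.map (fun p => (C (coeff D p) : MvPolynomial (Fin n) F)) with hP0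
  set Q0 := Q.map (fun p => (C (coeff D p) : MvPolynomial (Fin n) F)) with hQ0
  have hP1 : P0 = (C δ : MvPolynomial (Fin n) F) • 1 - cMat n G0 * EI := by
    refine Matrix.ext fun i j => ?_
    simp only [hP0, Matrix.map_apply, hPc, Matrix.sub_apply, Matrix.smul_apply, Matrix.one_apply,
      Matrix.mul_apply, EI, G0, cMat, Matrix.of_apply, Matrix.submatrix_apply, id, map_sub, map_sum, map_mul, smul_eq_mul]
    congr 1
    · split_ifs <;> simp [hδ]
    · exact Finset.sum_congr rfl fun s _ => by split_ifs <;> simp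
  have hQ1 : Q0 = (C δ : MvPolynomial (Fin n) F) • 1 - EJ * cMat n H0 := by
    refine Matrix.ext fun i j => ?_
    simp only [hQ0, Matrix.map_apply, hQc, Matrix.sub_apply, Matrix.smul_apply, Matrix.one_apply,
      Matrix.mul_apply, EJ, H0, cMat, Matrix.of_apply, Matrix.submatrix_apply, id, map_sub, map_sum, map_mul, smul_eq_mul]
    congr 1
    · split_ifs <;> simp [hδ]
    · exact Finset.sum_congr rfl fun s _ => by split_ifs <;> simp
  have hCδ : (C δ⁻¹ : MvPolynomial (Fin n) F) * C δ = 1 := by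
    rw [← C_mul, inv_mul_cancel₀ hδ0, C_1]
  -- `δ² M = δ G M_I + (P0 M)_J H`
  have e1 : (C δ : MvPolynomial (Fin n) F) • P0 * M = P0 * M * EJ * cMat n H0 := by
    rw [hQ1, Matrix.mul_sub, Matrix.mul_smul, Matrix.mul_one, ← Matrix.mul_assoc, sub_eq_zero] at key
    rw [Matrix.smul_mul, key]
  have e2 : P0 * M = (C δ : MvPolynomial (Fin n) F) • M - cMat n G0 * M.submatrix I id := by
    rw [hP1, Matrix.sub_mul, Matrix.smul_mul, Matrix.one_mul, Matrix.mul_assoc, hEI]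
  have e3 : P0 * M = (C δ⁻¹ : MvPolynomial (Fin n) F) • (P0 * M * EJ * cMat n H0) := by
    rw [← e1, Matrix.smul_mul, smul_smul, hCδ, one_smul]
  have e4 : M = (C δ⁻¹ : MvPolynomial (Fin n) F) • (cMat n G0 * M.submatrix I id + P0 * M) := by
    rw [e2, add_sub_cancel, smul_smul, hCδ, one_smul]
  have hmapC : ∀ {p q : ℕ} (c : F) (N : Matrix (Fin p) (Fin q) F),
      cMat n (c • N) = (C c : MvPolynomial (Fin n) F) • cMat n N := by
    intro p q c N; refine Matrix.ext fun i j => ?_; simp [cMat]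
  have hP0M : ∀ i j, ((P0 * M) i j).IsHomogeneous 1 := by
    intro i j
    rw [Matrix.mul_apply]
    refine IsHomogeneous.sum _ _ _ fun k _ => ?_
    have := (isHomogeneous_C (Fin n) (coeff D (P i k))).mul (hM k j)
    simpa [hP0] using this
  refine aux_decomp M (δ⁻¹ • G0) (M.submatrix I id) ((P0 * M).submatrix id J)
    ((δ⁻¹ * δ⁻¹) • H0) (fun i j => hM _ _) (fun i j => hP0M _ _) ?_
  have e5 : (P0 * M).submatrix id J = P0 * M * EJ := by
    refine Matrix.ext fun i j => ?_; simp [EJ, Matrix.mul_apply (M := P0 * M), Matrix.one_apply]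
  rw [e5, hmapC, hmapC, Matrix.smul_mul, Matrix.mul_smul, map_mul, ← smul_smul, ← e3, ← smul_add]
  exact e4

/-- For any field and any matrix of linear forms, `PR(M) ≤ 2 · CR(M)`. -/
theorem statement_5 (F : Type*) [Field F] (n a b : ℕ) (hn : 1 ≤ n)
    (M : Matrix (Fin a) (Fin b) (MvPolynomial (Fin n) F))
    (hM : ∀ i j, (M i j).IsHomogeneous 1) :
    PR1 M ≤ 2 * CR M := by
  rw [two_mul]
  exact Nat.sInf_le (aux_main M hM rfl)
end

section
/- For any 3-tensor T over a finite field F_q, the slice rank satisfies SR(T) ≤ (3 + 2/(q−1)) · AR(T), where AR(T) = −log_q bias(T) is the analytic rank. -/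
open MvPolynomial

section MSZ
variable {F : Type*} [Field F]

/-- Translation of a polynomial by a point. -/
noncomputable def shiftP {m : ℕ} (p : Fin m → F) :
    MvPolynomial (Fin m) F →ₐ[F] MvPolynomial (Fin m) F :=
  aeval (fun i => X i + C (p i))

lemma shiftP_ne_zero {m : ℕ} (p : Fin m → F) (f : MvPolynomial (Fin m) F) (hf : f ≠ 0) :
    shiftP p f ≠ 0 := by
  intro h
  apply hf
  have h2 : (shiftP (-p)).comp (shiftP p) = AlgHom.id F _ := by
    apply MvPolynomial.algHom_ext
    intro i
    simp [shiftP]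
  have := congrArg (shiftP (-p)) h
  rw [← AlgHom.comp_apply, h2] at this
  simpa using this

lemma finSucc_shift {m : ℕ} (p : Fin m → F) (c : F) (f : MvPolynomial (Fin (m+1)) F) :
    finSuccEquiv F m (shiftP (Fin.cons c p : Fin (m+1) → F) f) =
      Polynomial.taylor (C c) ((finSuccEquiv F m f).map (shiftP p).toRingHom) := by
  have : (finSuccEquiv F m).toAlgHom.toRingHom.comp
      (shiftP (Fin.cons c p : Fin (m+1) → F)).toRingHom =
      ((Polynomial.taylorAlgHom (C c : MvPolynomial (Fin m) F)).toRingHom.comp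
        (Polynomial.mapRingHom (shiftP p).toRingHom)).comp
        (finSuccEquiv F m).toAlgHom.toRingHom := by
    apply MvPolynomial.ringHom_ext
    · intro r
      simp [shiftP, finSuccEquiv_apply]
    · intro i
      refine Fin.cases ?_ (fun j => ?_) i
      · simp [shiftP, finSuccEquiv_apply]
      · simp [shiftP, finSuccEquiv_apply]
  exact congrArg (fun g => g f) this

/-- Coefficientwise extraction of a monomial. -/
noncomputable def exP {m : ℕ} (α : Fin m →₀ ℕ) (P : Polynomial (MvPolynomial (Fin m) F)) :
    Polynomial F :=
  ∑ i ∈ Finset.range (P.natDegree + 1), Polynomial.monomial i (coeff α (P.coeff i))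

lemma exP_coeff {m : ℕ} (α : Fin m →₀ ℕ) (P : Polynomial (MvPolynomial (Fin m) F)) (i : ℕ) :
    (exP α P).coeff i = coeff α (P.coeff i) := by
  simp only [exP, Polynomial.finsetSum_coeff, Polynomial.coeff_monomial]
  rw [Finset.sum_ite_eq']
  split_ifs with h
  · rfl
  · rw [Polynomial.coeff_eq_zero_of_natDegree_lt]
    · simp
    · simpa using h

lemma exP_taylor {m : ℕ} (α : Fin m →₀ ℕ) (P : Polynomial (MvPolynomial (Fin m) F)) (c : F)
    (j : ℕ) :
    (Polynomial.taylor c (exP α P)).coeff j = coeff α ((Polynomial.taylor (C c) P).coeff j) := by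
  conv_rhs => rw [P.as_sum_range]
  rw [exP]
  simp only [map_sum, Polynomial.finsetSum_coeff, Polynomial.taylor_monomial, coeff_sum,
    Polynomial.coeff_C_mul, Polynomial.coeff_X_add_C_pow]
  refine Finset.sum_congr rfl fun i _ => ?_
  rw [show (P.coeff i * ((C c : MvPolynomial (Fin m) F) ^ (i - j) * (i.choose j : MvPolynomial (Fin m) F)))
    = C (c ^ (i-j) * (i.choose j : F)) * P.coeff i by simp; ring, coeff_C_mul]
  ring

lemma uni_mult [Fintype F] (h : Polynomial F) (hh : h ≠ 0) (ν : F → ℕ)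
    (hν : ∀ c, ∀ j < ν c, (Polynomial.taylor c h).coeff j = 0) :
    ∑ c, ν c ≤ h.natDegree := by
  classical
  calc ∑ c, ν c ≤ ∑ c, h.roots.count c := by
        refine Finset.sum_le_sum fun c _ => ?_
        rw [Polynomial.count_roots, Polynomial.le_rootMultiplicity_iff hh]
        have := (Polynomial.X_pow_dvd_iff (f := Polynomial.taylor c h) (n := ν c)).2 (hν c)
        obtain ⟨g, hg⟩ := this
        refine ⟨Polynomial.taylor (-c) g, ?_⟩
        have h2 := congrArg (Polynomial.taylor (-c)) hg
        rw [Polynomial.taylor_taylor, Polynomial.taylor_mul, Polynomial.taylor_pow] at h2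
        simpa [sub_eq_add_neg] using h2
    _ = h.roots.card := by
        rw [Multiset.sum_count_eq_card]; simp
    _ ≤ h.natDegree := Polynomial.card_roots' h

/-- Multiplicity Schwartz-Zippel. -/
theorem msz [Fintype F] : ∀ (m : ℕ) (f : MvPolynomial (Fin m) F) (_ : f ≠ 0)
    (μ : (Fin m → F) → ℕ)
    (_ : ∀ p, ∀ e, coeff e (shiftP p f) ≠ 0 → μ p ≤ e.degree),
    Fintype.card F * ∑ p, μ p ≤ f.totalDegree * Fintype.card F ^ m := by
  classical
  intro m
  induction m with
  | zero =>
    intro f hf μ hμ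
    have h0 : ∀ p, μ p = 0 := by
      intro p
      obtain ⟨e, he⟩ := MvPolynomial.ne_zero_iff.1 (shiftP_ne_zero p f hf)
      have := hμ p e he
      have he0 : e = 0 := Subsingleton.elim _ _
      simpa [he0] using this
    simp [h0]
  | succ m ih =>
    intro f hf μ hμ
    set P := finSuccEquiv F m f with hP
    have hP0 : P ≠ 0 := by simpa [hP] using hf
    set k := P.natDegree with hk
    set g := P.coeff k with hg
    have hg0 : g ≠ 0 := by
      rw [hg, hk]; exact Polynomial.leadingCoeff_ne_zero.2 hP0
    have hdeg : g.totalDegree + k ≤ f.totalDegree := totalDegree_coeff_finSuccEquiv_add_le f k hg0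
    -- minimal degree monomials of `g` at every point
    have hmin : ∀ p : Fin m → F, ∃ α, coeff α (shiftP p g) ≠ 0 ∧
        ∀ e, coeff e (shiftP p g) ≠ 0 → α.degree ≤ e.degree := by
      intro p
      have hs : (shiftP p g).support.Nonempty := support_nonempty.2 (shiftP_ne_zero p g hg0)
      obtain ⟨α, h1, h2⟩ := Finset.exists_min_image _ (fun e => Finsupp.degree e) hs
      exact ⟨α, by simpa using h1, fun e he => h2 e (by simpa using he)⟩
    choose α hα1 hα2 using hmin
    have key : ∀ p : Fin m → F, ∑ c, μ (Fin.cons c p) ≤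
        Fintype.card F * (α p).degree + k := by
      intro p
      set Q := P.map (shiftP p).toRingHom with hQ
      have hc : (exP (α p) Q).coeff k ≠ 0 := by
        rw [exP_coeff, hQ, Polynomial.coeff_map]; exact hα1 p
      have hne : exP (α p) Q ≠ 0 := by intro h; simp [h] at hc
      have hnd : (exP (α p) Q).natDegree ≤ k := by
        rw [Polynomial.natDegree_le_iff_coeff_eq_zero]
        intro N hN
        rw [exP_coeff, hQ, Polynomial.coeff_map, Polynomial.coeff_eq_zero_of_natDegree_lt hN]
        simp
      have h1 := uni_mult (exP (α p) Q) hne (fun c => μ (Fin.cons c p) - (α p).degree) (by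
        intro c j hj
        by_contra hcon
        rw [exP_taylor, hQ, ← finSucc_shift, finSuccEquiv_coeff_coeff] at hcon
        have := hμ _ _ hcon
        have hd : ((α p).cons j).degree = j + (α p).degree := by
          simp [Finsupp.degree_eq_sum, Fin.sum_univ_succ]
        omega)
      calc ∑ c, μ (Fin.cons c p) ≤ ∑ c : F, ((α p).degree + (μ (Fin.cons c p) - (α p).degree)) :=
            Finset.sum_le_sum fun c _ => by omega
        _ ≤ _ := by
            rw [Finset.sum_add_distrib]; simp; omega
    have hih := ih g hg0 (fun p => (α p).degree) (fun p e he => hα2 p e he)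
    have hsum : ∑ p, μ p = ∑ p : Fin m → F, ∑ c, μ (Fin.cons c p) := by
      rw [← (Fin.consEquiv (fun _ => F)).sum_comp, Fintype.sum_prod_type, Finset.sum_comm]
      rfl
    have h2 : ∑ p, μ p ≤ Fintype.card F * ∑ p, (α p).degree + k * Fintype.card F ^ m := by
      rw [hsum]
      refine (Finset.sum_le_sum fun p _ => key p).trans ?_
      rw [Finset.sum_add_distrib, Finset.mul_sum]; simp [mul_comm]
    calc Fintype.card F * ∑ p, μ p ≤
          Fintype.card F * (g.totalDegree * Fintype.card F ^ m + k * Fintype.card F ^ m) := by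
            gcongr; omega
      _ = (g.totalDegree + k) * Fintype.card F ^ (m+1) := by ring
      _ ≤ _ := by gcongr
end MSZ
section Minors

open Matrix in
lemma exists_rows {K : Type*} [Field K] {a b r : ℕ} (A : Matrix (Fin a) (Fin b) K)
    (hr : A.rank = r) :
    ∃ g : Fin r → Fin a, LinearIndependent K (A.submatrix g id).row := by
  rw [A.rank_eq_finrank_span_row] at hr
  subst hr
  obtain ⟨f, h1, h2, h3⟩ := Submodule.exists_fun_fin_finrank_span_eq K (Set.range A.row)
  choose g hg using h1
  refine ⟨g, ?_⟩
  convert! h3 using 1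
  ext i j
  rw [← hg i]; rfl

open Matrix in
lemma exists_minor {K : Type*} [Field K] {a b r : ℕ} (A : Matrix (Fin a) (Fin b) K)
    (hr0 : A.rank = r) :
    ∃ (g : Fin r → Fin a) (h : Fin r → Fin b), (A.submatrix g h).det ≠ 0 := by
  obtain ⟨g, hg⟩ := exists_rows A hr0
  have hr : (A.submatrix g id).rank = r := by
    rw [LinearIndependent.rank_matrix hg]; simp
  have hr2 : (A.submatrix g id)ᵀ.rank = r := by rw [Matrix.rank_transpose, hr]
  obtain ⟨h, hh⟩ := exists_rows (A.submatrix g id)ᵀ hr2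
  refine ⟨g, h, ?_⟩
  have h1 := Matrix.linearIndependent_rows_iff_isUnit.1 hh
  rw [Matrix.isUnit_iff_isUnit_det, ← Matrix.det_transpose] at h1
  exact h1.ne_zero

variable {F : Type*} [Field F]

/-- The matrix of linear forms attached to a tuple of matrices. -/
noncomputable def linM {m a b : ℕ} (A : Fin m → Matrix (Fin a) (Fin b) F) :
    Matrix (Fin a) (Fin b) (MvPolynomial (Fin m) F) :=
  Matrix.of fun i j => ∑ k, C (A k i j) * X k

lemma piecewise_det {m r : ℕ} (S : Finset (Fin r)) (N : Matrix (Fin r) (Fin r) F)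
    (L : Matrix (Fin r) (Fin r) (MvPolynomial (Fin m) F))
    (hL : ∀ i j, (L i j).IsHomogeneous 1) (e : Fin m →₀ ℕ)
    (he : coeff e (Matrix.det (Matrix.of (S.piecewise (N.map C) L))) ≠ 0) :
    r - N.rank ≤ e.degree := by
  classical
  have hS : S.card ≤ N.rank := by
    by_contra hcon
    have hnli : ¬ LinearIndependent F (fun i : S => N.row i) := by
      intro hli
      have h1 := LinearIndependent.rank_matrix (M := N.submatrix (fun i : S => (i : Fin r)) id) hli
      have h2 := Matrix.rank_submatrix_le N (fun i : S => (i : Fin r)) id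
      simp at h1
      omega
    rw [Fintype.not_linearIndependent_iff] at hnli
    obtain ⟨c, hc, i0, hi0⟩ := hnli
    apply he
    rw [(Matrix.exists_vecMul_eq_zero_iff
      (M := Matrix.of (S.piecewise (N.map C) L))).1, coeff_zero]
    refine ⟨fun i => if h : i ∈ S then C (c ⟨i, h⟩) else 0, ?_, ?_⟩
    · intro h
      have := congrFun h i0
      simp [hi0] at this
    · ext1 j
      have h3 := congrArg (C (σ := Fin m)) (congrFun hc j)
      simp only [Matrix.vecMul, dotProduct, Pi.zero_apply, Matrix.of_apply]
      rw [← Finset.sum_subset (Finset.subset_univ S) (fun i _ hi => by simp [hi]),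
        ← Finset.sum_coe_sort S]
      simp [Matrix.row] at h3
      rw [← h3]
      refine Finset.sum_congr rfl fun i _ => ?_
      have hi : S.piecewise (N.map C) L (i : Fin r) = (N.map C) i :=
        Finset.piecewise_eq_of_mem _ _ _ i.2
      rw [hi]; simp
  have hhom : (Matrix.det (Matrix.of (S.piecewise (N.map C) L))).IsHomogeneous (r - S.card) := by
    rw [Matrix.det_apply]
    refine IsHomogeneous.sum _ _ _ fun σ _ => ?_
    have hp : (∏ i, (Matrix.of (S.piecewise (N.map C) L)) (σ i) i).IsHomogeneous
        (∑ i, if σ i ∈ S then 0 else 1) := by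
      refine IsHomogeneous.prod _ _ _ fun i _ => ?_
      by_cases h : σ i ∈ S
      · have hi : S.piecewise (N.map C) L (σ i) = (N.map C) (σ i) :=
          Finset.piecewise_eq_of_mem _ _ _ h
        rw [if_pos h, Matrix.of_apply, hi]
        exact isHomogeneous_C _ _
      · have hi : S.piecewise (N.map C) L (σ i) = L (σ i) :=
          Finset.piecewise_eq_of_notMem _ _ _ h
        rw [if_neg h, Matrix.of_apply, hi]
        exact hL _ _
    have hs : (∑ i, if σ i ∈ S then 0 else 1) = r - S.card := by
      rw [Equiv.sum_comp σ (fun i => if i ∈ S then 0 else 1)]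
      simp [Finset.sum_ite, Finset.filter_not, ← Finset.compl_eq_univ_sdiff, Finset.card_compl]
    rw [hs] at hp
    rcases Int.units_eq_one_or (Equiv.Perm.sign σ) with h | h
    · rw [h, one_smul]; exact hp
    · rw [h, Units.neg_smul, one_smul]; exact hp.neg
  have := hhom he
  have h2 : Finsupp.degree e = r - S.card := by
    rw [← this, Finsupp.degree_eq_weight_one]; rfl
  omega

lemma minor_mult {m a r : ℕ} (A : Fin m → Matrix (Fin a) (Fin a) F) (g h : Fin r → Fin a)
    (p : Fin m → F) (e : Fin m →₀ ℕ)
    (he : coeff e (shiftP p ((linM A).submatrix g h).det) ≠ 0) :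
    r - (∑ k, p k • A k).rank ≤ e.degree := by
  classical
  set N : Matrix (Fin r) (Fin r) F := (∑ k, p k • A k).submatrix g h with hN
  set L := (linM A).submatrix g h with hL
  have hsh : shiftP p L.det = (Matrix.of ((N.map C : Matrix _ _ (MvPolynomial (Fin m) F)) + L)).det := by
    rw [AlgHom.map_det]
    congr 1
    ext1 i j
    simp [hN, hL, linM, shiftP, mul_add, Finset.sum_add_distrib]
    rw [add_comm]
    congr 1
    rw [Matrix.map_apply, Matrix.submatrix_apply, Matrix.sum_apply, map_sum]
    exact Finset.sum_congr rfl fun k _ => by simp [mul_comm]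
  have hexp : shiftP p L.det = ∑ S : Finset (Fin r),
      (Matrix.of (S.piecewise (N.map C : Matrix _ _ (MvPolynomial (Fin m) F)) L)).det := by
    rw [hsh]
    exact (Matrix.detRowAlternating (R := MvPolynomial (Fin m) F)).map_add_univ
      (fun i => (N.map C : Matrix _ _ (MvPolynomial (Fin m) F)) i) (fun i => L i)
  rw [hexp, coeff_sum] at he
  obtain ⟨S, _, hS⟩ := Finset.exists_ne_zero_of_sum_ne_zero he
  have h1 := piecewise_det S N L (by
    intro i j
    simp only [hL, linM, Matrix.submatrix_apply, Matrix.of_apply]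
    refine IsHomogeneous.sum _ _ _ fun k _ => ?_
    simpa using (isHomogeneous_C _ _).mul (isHomogeneous_X F k)) e hS
  have h2 : N.rank ≤ _ := Matrix.rank_submatrix_le (∑ k, p k • A k) g h
  omega
end Minors

section Lead
open Matrix
variable {F : Type*} [Field F]

/-- `c` is the lexicographic leading coefficient of the polynomial vector `v`
(or zero) at the exponent `e`. -/
def IsLead {m n : ℕ} (v : Fin n → MvPolynomial (Fin m) F) (e : Fin m →₀ ℕ)
    (c : Fin n → F) : Prop :=
  ∀ j, (MonomialOrder.lex (σ := Fin m)).toSyn (MonomialOrder.lex.degree (v j)) ≤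
    (MonomialOrder.lex (σ := Fin m)).toSyn e ∧ coeff e (v j) = c j

lemma exists_lead {m n : ℕ} (v : Fin n → MvPolynomial (Fin m) F) (hv : v ≠ 0) :
    ∃ e c, c ≠ 0 ∧ IsLead v e c := by
  classical
  set S : Finset (Fin m →₀ ℕ) := Finset.univ.biUnion fun j => (v j).support with hS
  have hne : S.Nonempty := by
    obtain ⟨j, hj⟩ := Function.ne_iff.1 hv
    obtain ⟨e, he⟩ := support_nonempty.2 hj
    exact ⟨e, Finset.mem_biUnion.2 ⟨j, Finset.mem_univ _, he⟩⟩
  obtain ⟨e, he, hmax⟩ := Finset.exists_max_image S (MonomialOrder.lex (σ := Fin m)).toSyn hne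
  refine ⟨e, fun j => coeff e (v j), ?_, fun j => ⟨?_, rfl⟩⟩
  · obtain ⟨j, _, hj⟩ := Finset.mem_biUnion.1 he
    intro h
    exact (mem_support_iff.1 hj) (congrFun h j)
  · rw [MonomialOrder.degree_le_iff]
    intro c hc
    exact hmax c (Finset.mem_biUnion.2 ⟨j, Finset.mem_univ _, hc⟩)

/-- The span of the leading coefficients of the right kernel. -/
def leadKer {m n : ℕ} (M : Matrix (Fin n) (Fin n) (MvPolynomial (Fin m) F)) :
    Submodule F (Fin n → F) :=
  Submodule.span F {c | ∃ v e, M *ᵥ v = 0 ∧ IsLead v e c}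

lemma leadKer_finrank {m n : ℕ} (M : Matrix (Fin n) (Fin n) (MvPolynomial (Fin m) F)) :
    n ≤ Module.finrank F (leadKer M) +
      (M.map (algebraMap _ (FractionRing (MvPolynomial (Fin m) F)))).rank := by
  classical
  by_contra hcon
  push Not at hcon
  set K := FractionRing (MvPolynomial (Fin m) F) with hK
  set MK := M.map (algebraMap _ K) with hMK
  set d := Module.finrank F (leadKer M) with hd
  -- a linear map which is injective on `leadKer M`
  let eqv : (Fin d → F) ≃ₗ[F] leadKer M := (Module.finBasis F (leadKer M)).equivFun.symm
  obtain ⟨π, hπ⟩ := LinearMap.exists_leftInverse_of_injective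
    ((leadKer M).subtype ∘ₗ eqv.toLinearMap)
    (LinearMap.ker_eq_bot.2 (Subtype.val_injective.comp eqv.injective))
  set P := LinearMap.toMatrix' π with hP
  have hPinj : ∀ c ∈ leadKer M, P *ᵥ c = 0 → c = 0 := by
    intro c hc h0
    have h1 : π c = 0 := by rw [← h0, hP, LinearMap.toMatrix'_mulVec]
    have h2 := congrArg (fun g => g (eqv.symm ⟨c, hc⟩)) hπ
    simp [h1] at h2
    simpa using h2.symm
  set PK : Matrix (Fin d) (Fin n) K := P.map (algebraMap F K) with hPK
  have hk1 := MK.mulVecLin.finrank_range_add_finrank_ker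
  have hk2 := PK.mulVecLin.finrank_range_add_finrank_ker
  have hr2 : Module.finrank K (LinearMap.range PK.mulVecLin) ≤ d := by
    have := PK.rank_le_height
    exact this
  have hk3 := Submodule.finrank_sup_add_finrank_inf_eq (LinearMap.ker MK.mulVecLin)
    (LinearMap.ker PK.mulVecLin)
  have hk4 := Submodule.finrank_le (LinearMap.ker MK.mulVecLin ⊔ LinearMap.ker PK.mulVecLin)
  have hr1 : MK.rank = Module.finrank K (LinearMap.range MK.mulVecLin) := rfl
  simp only [Module.finrank_fin_fun] at hk1 hk2 hk4
  have hpos : 0 < Module.finrank K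
      ↥(LinearMap.ker MK.mulVecLin ⊓ LinearMap.ker PK.mulVecLin) := by omega
  have hnt := Module.finrank_pos_iff.1 hpos
  obtain ⟨⟨w, hw1, hw2⟩, hw0⟩ := exists_ne
    (0 : ↥(LinearMap.ker MK.mulVecLin ⊓ LinearMap.ker PK.mulVecLin))
  have hw0' : w ≠ 0 := fun h => hw0 (Subtype.ext h)
  have hw1' : MK *ᵥ w = 0 := hw1
  have hw2' : PK *ᵥ w = 0 := hw2
  obtain ⟨b, hb⟩ := IsLocalization.exist_integer_multiples_of_finite
    (nonZeroDivisors (MvPolynomial (Fin m) F)) w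
  choose v hv using hb
  have hinj : Function.Injective (algebraMap (MvPolynomial (Fin m) F) K) :=
    IsFractionRing.injective _ _
  have hvw : (fun j => algebraMap (MvPolynomial (Fin m) F) K (v j)) =
      (algebraMap _ K (b : MvPolynomial (Fin m) F)) • w := by
    ext j
    rw [hv j, Algebra.smul_def]; rfl
  have hv0 : v ≠ 0 := by
    intro h
    obtain ⟨j, hj⟩ := Function.ne_iff.1 hw0'
    have h1 := congrFun hvw j
    simp [h] at h1
    exact hj h1
  have hMv : M *ᵥ v = 0 := by
    ext1 i
    apply hinj
    have h1 : MK *ᵥ (fun j => algebraMap (MvPolynomial (Fin m) F) K (v j)) = 0 := by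
      rw [hvw, Matrix.mulVec_smul, hw1', smul_zero]
    have h2 := congrFun h1 i
    simpa [Matrix.mulVec, dotProduct, hMK] using h2
  have hPv : (P.map C) *ᵥ v = 0 := by
    ext1 i
    apply hinj
    have h1 : PK *ᵥ (fun j => algebraMap (MvPolynomial (Fin m) F) K (v j)) = 0 := by
      rw [hvw, Matrix.mulVec_smul, hw2', smul_zero]
    have h2 := congrFun h1 i
    simp only [Matrix.mulVec, dotProduct, hPK, Matrix.map_apply,
      IsScalarTower.algebraMap_apply F (MvPolynomial (Fin m) F) K, ← map_mul, ← map_sum] at h2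
    simpa [Matrix.mulVec, dotProduct, MvPolynomial.algebraMap_eq] using h2
  obtain ⟨e, c, hc0, hc⟩ := exists_lead v hv0
  apply hc0
  apply hPinj c (Submodule.subset_span ⟨v, e, hMv, hc⟩)
  ext1 i
  have h1 := congrArg (coeff e) (congrFun hPv i)
  simp only [Matrix.mulVec, dotProduct, Matrix.map_apply, coeff_sum, coeff_C_mul,
    (hc _).2, Pi.zero_apply, coeff_zero] at h1
  exact h1

lemma linM_pderiv {m n : ℕ} (A : Fin m → Matrix (Fin n) (Fin n) F)
    (u v : Fin n → MvPolynomial (Fin m) F) (hu : u ᵥ* linM A = 0) (hv : linM A *ᵥ v = 0)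
    (k : Fin m) : ∑ i, ∑ j, C (A k i j) * (u i * v j) = 0 := by
  have h1 : ∀ i, ∑ j, C (A k i j) * v j + ∑ j, linM A i j * pderiv k (v j) = 0 := by
    intro i
    have h2 := congrArg (pderiv k) (congrFun hv i)
    simp only [Matrix.mulVec, dotProduct, map_sum, Derivation.leibniz, Pi.zero_apply, map_zero,
      smul_eq_mul, Finset.sum_add_distrib] at h2
    rw [← h2, add_comm]
    congr 1
    refine Finset.sum_congr rfl fun j _ => ?_
    rw [mul_comm]
    congr 1
    simp [linM, Derivation.leibniz, pderiv_X, Pi.single_apply]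
  have h3 : ∑ i, u i * (∑ j, C (A k i j) * v j + ∑ j, linM A i j * pderiv k (v j)) = 0 := by
    simp [h1]
  simp only [mul_add, Finset.sum_add_distrib] at h3
  have h4 : ∑ i, u i * ∑ j, linM A i j * pderiv k (v j) = 0 := by
    have : u ᵥ* linM A ⬝ᵥ (fun j => pderiv k (v j)) = 0 := by rw [hu]; simp
    rw [← Matrix.dotProduct_mulVec] at this
    exact this
  rw [h4, add_zero] at h3
  rw [← h3]
  refine Finset.sum_congr rfl fun i _ => ?_
  rw [Finset.mul_sum]
  exact Finset.sum_congr rfl fun j _ => by ring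

lemma lead_vanish {m n : ℕ} (A : Fin m → Matrix (Fin n) (Fin n) F) (k : Fin m)
    (a b : Fin n → F) (ha : a ∈ leadKer (linM A)ᵀ) (hb : b ∈ leadKer (linM A)) :
    ∑ i, ∑ j, A k i j * (a i * b j) = 0 := by
  let B : (Fin n → F) →ₗ[F] (Fin n → F) →ₗ[F] F := Matrix.toLinearMap₂' F (A k)
  have hB : ∀ a b, B a b = ∑ i, ∑ j, A k i j * (a i * b j) := by
    intro a b
    simp only [B, Matrix.toLinearMap₂'_apply, smul_eq_mul]
    exact Finset.sum_congr rfl fun i _ => Finset.sum_congr rfl fun j _ => by ring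
  rw [← hB]
  have step : ∀ a ∈ {c | ∃ v e, (linM A)ᵀ *ᵥ v = 0 ∧ IsLead v e c},
      ∀ b ∈ {c | ∃ v e, (linM A) *ᵥ v = 0 ∧ IsLead v e c}, B a b = 0 := by
    rintro a ⟨u, e, hu, hue⟩ b ⟨v, e', hv, hve⟩
    rw [Matrix.mulVec_transpose] at hu
    have h1 := congrArg (coeff (e + e')) (linM_pderiv A u v hu hv k)
    simp only [coeff_sum, coeff_C_mul, coeff_zero] at h1
    rw [hB, ← h1]
    refine Finset.sum_congr rfl fun i _ => Finset.sum_congr rfl fun j _ => ?_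
    rw [MonomialOrder.coeff_mul_of_add_of_degree_le (hue i).1 (hve j).1, (hue i).2, (hve j).2]
  have step2 : ∀ a ∈ {c | ∃ v e, (linM A)ᵀ *ᵥ v = 0 ∧ IsLead v e c},
      ∀ b ∈ leadKer (linM A), B a b = 0 := by
    intro a ha b hb
    have : leadKer (linM A) ≤ LinearMap.ker (B a) :=
      Submodule.span_le.2 fun c hc => step a ha c hc
    exact this hb
  have : leadKer (linM A)ᵀ ≤ LinearMap.ker (B.flip b) :=
    Submodule.span_le.2 fun c hc => step2 c hc b hb
  exact this ha
end Lead

section Core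
open Matrix
variable {F : Type*} [Field F]

lemma det_hom {m r : ℕ} (L : Matrix (Fin r) (Fin r) (MvPolynomial (Fin m) F))
    (hL : ∀ i j, (L i j).IsHomogeneous 1) : L.det.IsHomogeneous r := by
  rw [Matrix.det_apply]
  refine IsHomogeneous.sum _ _ _ fun σ _ => ?_
  have hp : (∏ i, L (σ i) i).IsHomogeneous (∑ i : Fin r, 1) :=
    IsHomogeneous.prod _ _ _ fun i _ => hL _ _
  simp only [Finset.sum_const, Finset.card_univ, Fintype.card_fin, smul_eq_mul, mul_one] at hp
  rcases Int.units_eq_one_or (Equiv.Perm.sign σ) with h | h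
  · rw [h, one_smul]; exact hp
  · rw [h, Units.neg_smul, one_smul]; exact hp.neg

theorem core_s6 [Fintype F] {m n : ℕ} (A : Fin m → Matrix (Fin n) (Fin n) F) :
    ∃ (r : ℕ) (U W : Submodule F (Fin n → F)),
      n ≤ Module.finrank F U + r ∧ n ≤ Module.finrank F W + r ∧
      (∀ k, ∀ a ∈ U, ∀ b ∈ W, ∑ i, ∑ j, A k i j * (a i * b j) = 0) ∧
      Fintype.card F * (r * Fintype.card F ^ m) ≤
        Fintype.card F * (∑ p : Fin m → F, (∑ k, p k • A k).rank) + r * Fintype.card F ^ m := by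
  classical
  set K := FractionRing (MvPolynomial (Fin m) F) with hK
  set r := ((linM A).map (algebraMap _ K)).rank with hr
  refine ⟨r, leadKer (linM A)ᵀ, leadKer (linM A), ?_, leadKer_finrank _,
    fun k a ha b hb => lead_vanish A k a b ha hb, ?_⟩
  · have := leadKer_finrank (linM A)ᵀ
    rwa [Matrix.transpose_map, Matrix.rank_transpose] at this
  · obtain ⟨g, h, hgh⟩ := exists_minor _ hr.symm
    have hdet : ((linM A).submatrix g h).det ≠ 0 := by
      intro h0
      apply hgh
      have := congrArg (algebraMap _ K) h0
      rw [RingHom.map_det, map_zero] at this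
      exact this
    have hdeg : ((linM A).submatrix g h).det.totalDegree ≤ r := by
      apply IsHomogeneous.totalDegree_le
      apply det_hom
      intro i j
      simp only [linM, Matrix.submatrix_apply, Matrix.of_apply]
      refine IsHomogeneous.sum _ _ _ fun k _ => ?_
      simpa using (isHomogeneous_C _ _).mul (isHomogeneous_X F k)
    have h1 := msz m _ hdet (fun p => r - (∑ k, p k • A k).rank)
      (fun p e he => minor_mult A g h p e he)
    have h2 : r * Fintype.card F ^ m ≤ (∑ p : Fin m → F, (∑ k, p k • A k).rank) +
        ∑ p : Fin m → F, (r - (∑ k, p k • A k).rank) := by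
      rw [← Finset.sum_add_distrib]
      calc r * Fintype.card F ^ m = ∑ p : Fin m → F, r := by simp [mul_comm]
        _ ≤ _ := Finset.sum_le_sum fun p _ => by omega
    calc _ ≤ Fintype.card F * ((∑ p : Fin m → F, (∑ k, p k • A k).rank) +
        ∑ p : Fin m → F, (r - (∑ k, p k • A k).rank)) := by gcongr
      _ ≤ _ := by
        rw [mul_add]
        exact Nat.add_le_add_left (h1.trans (Nat.mul_le_mul_right _ hdeg)) _
end Core

section Entropy

lemma entropy_bound {α : Type*} [Fintype α] (q n : ℕ) (hq : 1 < q)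
    (hα : Fintype.card α = q ^ n) (rk : α → ℕ) (hrk : ∀ x, rk x ≤ n) (Z : ℝ)
    (hZ : ∑ x, (q : ℝ) ^ (n - rk x) = Z) :
    ∑ x, (q : ℝ) ^ (n - rk x) * rk x ≤ Z * (- Real.logb q (Z / (q ^ n * q ^ n))) := by
  have hq0 : (0 : ℝ) < q := by positivity
  have hL : 0 < Real.log q := Real.log_pos (by exact_mod_cast hq)
  have hne : Nonempty α := by
    rw [← Fintype.card_pos_iff, hα]; positivity
  have hZpos : 0 < Z := by
    rw [← hZ]
    exact Finset.sum_pos (fun x _ => by positivity) Finset.univ_nonempty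
  have hterm : ∀ x, (q : ℝ) ^ (n - rk x) * (rk x * Real.log q) ≤
      (q : ℝ) ^ (n - rk x) * (2 * n * Real.log q - Real.log Z) -
        ((q : ℝ) ^ (n - rk x) - Z / q ^ n) := by
    intro x
    set N : ℝ := (q : ℝ) ^ (n - rk x) with hN
    have hNpos : 0 < N := by positivity
    have hlogN : Real.log N = (n - rk x) * Real.log q := by
      rw [hN, Real.log_pow, Nat.cast_sub (hrk x)]
    have h1 := Real.one_sub_inv_le_log_of_pos (x := N * q ^ n / Z) (by positivity)
    rw [Real.log_div (by positivity) (by positivity), Real.log_mul (by positivity) (by positivity),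
      hlogN, Real.log_pow] at h1
    have h2 := mul_le_mul_of_nonneg_left h1 hNpos.le
    have h3 : N * (1 - (N * q ^ n / Z)⁻¹) = N - Z / q ^ n := by
      field_simp
    rw [h3] at h2
    linarith
  have hsum := Finset.sum_le_sum fun x (_ : x ∈ Finset.univ) => hterm x
  rw [Finset.sum_sub_distrib, Finset.sum_sub_distrib, ← Finset.sum_mul, hZ] at hsum
  simp only [Finset.sum_const, Finset.card_univ, hα, nsmul_eq_mul, Nat.cast_pow] at hsum
  have h4 : (q : ℝ) ^ n * (Z / q ^ n) = Z := by field_simp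
  rw [h4, sub_self, sub_zero] at hsum
  have h5 : - Real.logb q (Z / (q ^ n * q ^ n)) =
      (2 * n * Real.log q - Real.log Z) / Real.log q := by
    rw [Real.logb, Real.log_div (by positivity) (by positivity),
      Real.log_mul (by positivity) (by positivity), Real.log_pow]
    ring
  rw [h5, ← mul_div_assoc, le_div_iff₀ hL, Finset.sum_mul]
  simpa [mul_assoc] using hsum
end Entropy

section Slices
variable {F : Type*} [Field F]

lemma mlo_sum {d n : ℕ} {ι : Type*} (S : Finset (Fin d)) (s : Finset ι)
    (f : ι → MvPolynomial (Fin d × Fin n) F) (h : ∀ t ∈ s, IsMultilinearOn S (f t)) :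
    IsMultilinearOn S (∑ t ∈ s, f t) := by
  classical
  intro m hm i
  have := support_sum hm
  obtain ⟨t, ht, hmt⟩ := Finset.mem_biUnion.1 this
  exact h t ht m hmt i

lemma mlo_C_mul {d n : ℕ} (S : Finset (Fin d)) (c : F) (f : MvPolynomial (Fin d × Fin n) F)
    (h : IsMultilinearOn S f) : IsMultilinearOn S (C c * f) := by
  intro m hm i
  refine h m ?_ i
  rw [mem_support_iff, coeff_C_mul] at hm
  exact mem_support_iff.2 (right_ne_zero_of_mul hm)

lemma mlo_X {d n : ℕ} (i : Fin d) (j : Fin n) :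
    IsMultilinearOn {i} (X (i, j) : MvPolynomial (Fin d × Fin n) F) := by
  classical
  intro m hm i'
  rw [support_X, Finset.mem_singleton] at hm
  subst hm
  by_cases h : i' = i
  · subst h; simp [Finsupp.single_apply]
  · simp [h]

lemma mlo_mul {d n : ℕ} (S S' : Finset (Fin d)) (f g : MvPolynomial (Fin d × Fin n) F)
    (hf : IsMultilinearOn S f) (hg : IsMultilinearOn S' g) (hd : Disjoint S S') :
    IsMultilinearOn (S ∪ S') (f * g) := by
  classical
  intro m hm i
  obtain ⟨a, ha, b, hb, rfl⟩ := Finset.mem_add.1 (support_mul f g hm)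
  simp only [Finsupp.add_apply, Finset.sum_add_distrib, hf a ha i, hg b hb i, Finset.mem_union]
  have : i ∈ S → i ∉ S' := fun h => Finset.disjoint_left.1 hd h
  by_cases h1 : i ∈ S <;> by_cases h2 : i ∈ S' <;> simp_all

/-- The trilinear form with coefficient array `a`. -/
noncomputable def triP {n : ℕ} (a : Fin n → Fin n → Fin n → F) :
    MvPolynomial (Fin 3 × Fin n) F :=
  ∑ i, ∑ j, ∑ k, C (a i j k) * (X (0, i) * X (1, j) * X (2, k))

lemma exists_triP {n : ℕ} (T : MvPolynomial (Fin 3 × Fin n) F) (hT : IsMultilinear T) :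
    ∃ a, T = triP a := by
  classical
  rw [T.as_sum]
  refine Finset.sum_induction _ (fun P => ∃ a, P = triP a) ?_ ?_ ?_
  · rintro _ _ ⟨a, rfl⟩ ⟨b, rfl⟩
    exact ⟨fun i j k => a i j k + b i j k, by simp [triP, add_mul, Finset.sum_add_distrib]⟩
  · exact ⟨0, by simp [triP]⟩
  · intro m hm
    have h1 : ∀ b : Fin 3, ∃ i, ∀ i', m (b, i') = if i = i' then 1 else 0 := by
      intro b
      have hs : ∑ j, m (b, j) = 1 := by simpa using hT m hm b
      obtain ⟨i, hi⟩ : ∃ i, m (b, i) ≠ 0 := by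
        by_contra hcon
        push Not at hcon
        simp [hcon] at hs
      rw [← Finset.add_sum_erase _ _ (Finset.mem_univ i)] at hs
      refine ⟨i, fun i' => ?_⟩
      split_ifs with h
      · subst h; omega
      · have := Finset.single_le_sum (f := fun j => m (b, j)) (fun _ _ => Nat.zero_le _)
          (Finset.mem_erase.2 ⟨fun e => h e.symm, Finset.mem_univ i'⟩)
        omega
    choose u hu using h1
    refine ⟨fun i j k => if i = u 0 then if j = u 1 then if k = u 2 then coeff m T else 0 else 0
      else 0, ?_⟩
    have hm' : m = Finsupp.single (0, u 0) 1 + Finsupp.single (1, u 1) 1 +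
        Finsupp.single (2, u 2) 1 := by
      ext ⟨b, i⟩
      rw [hu b i]
      fin_cases b <;> simp [Finsupp.single_apply]
    rw [triP, Finset.sum_eq_single (u 0), Finset.sum_eq_single (u 1), Finset.sum_eq_single (u 2)]
    · simp only [if_true]
      conv_lhs => rw [← mul_one (coeff m T), ← C_mul_monomial]
      congr 1
      conv_lhs => rw [hm']
      simp [X, monomial_mul]
    all_goals simp +contextual

lemma sub01_triP {n : ℕ} (a : Fin n → Fin n → Fin n → F) (x y : Fin n → F) :
    sub01 (triP a) x y = 0 ↔ ∀ k, ∑ i, ∑ j, a i j k * (x i * y j) = 0 := by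
  classical
  have h : sub01 (triP a) x y =
      ∑ k, C (∑ i, ∑ j, a i j k * (x i * y j)) * X ((2 : Fin 3), k) := by
    simp only [sub01, triP, map_sum, map_mul, aeval_X, algHom_C, algebraMap_eq]
    simp only [Finset.sum_mul]
    conv_rhs => rw [Finset.sum_comm]
    refine Finset.sum_congr rfl fun i _ => ?_
    conv_rhs => rw [Finset.sum_comm]
    refine Finset.sum_congr rfl fun j _ => Finset.sum_congr rfl fun k _ => ?_
    simp [mul_assoc]
  rw [h]
  constructor
  · intro h0 k
    have := congrArg (coeff (Finsupp.single ((2 : Fin 3), k) 1)) h0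
    simp only [coeff_sum, coeff_C_mul, coeff_zero] at this
    rw [Finset.sum_eq_single k] at this
    · simpa using this
    · intro k' _ hk'
      rw [coeff_X, if_neg, mul_zero]
      rw [Finsupp.single_left_inj one_ne_zero]
      simpa using hk'
    · simp
  · intro h0
    simp [h0]

lemma SR_le {n : ℕ} {ι : Type*} [Fintype ι] (T : MvPolynomial (Fin 3 × Fin n) F)
    (c : ι → Fin 3) (f g : ι → MvPolynomial (Fin 3 × Fin n) F)
    (hf : ∀ t, IsMultilinearOn {c t} (f t))
    (hg : ∀ t, IsMultilinearOn ({c t} : Finset (Fin 3))ᶜ (g t))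
    (hT : T = ∑ t, f t * g t) : SR T ≤ Fintype.card ι := by
  refine Nat.sInf_le ?_
  let e := (Fintype.equivFin ι).symm
  refine ⟨c ∘ e, f ∘ e, g ∘ e, fun t => hf _, fun t => hg _, ?_⟩
  rw [hT, ← e.sum_comp]; rfl

lemma split_sub {n : ℕ} (V : Submodule F (Fin n → F)) :
    ∃ (P : Fin n → Fin n → F) (d : ℕ) (c ψ : Fin d → Fin n → F),
      d + Module.finrank F V = n ∧ (∀ i', (fun i => P i i') ∈ V) ∧
      ∀ i i', P i i' + ∑ l, c l i * ψ l i' = if i = i' then 1 else 0 := by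
  classical
  obtain ⟨V', hV'⟩ := Submodule.exists_isCompl V
  let b := Module.finBasis F V'
  refine ⟨fun i i' => (V.projectionOnto V' hV' (Pi.single i' 1) : Fin n → F) i, 
    Module.finrank F V', fun l => (b l : Fin n → F),
    fun l i' => b.repr (V'.projectionOnto V hV'.symm (Pi.single i' 1)) l, ?_, ?_, ?_⟩
  · have := Submodule.finrank_add_eq_of_isCompl hV'
    simp at this
    omega
  · intro i'
    exact (V.projectionOnto V' hV' (Pi.single i' 1)).2
  · intro i i'
    have h1 := b.sum_repr (V'.projectionOnto V hV'.symm (Pi.single i' 1))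
    have h2 := congrFun (congrArg (Subtype.val) h1) i
    have h3 : (V.projectionOnto V' hV' (Pi.single i' 1) : Fin n → F) i +
        (V'.projectionOnto V hV'.symm (Pi.single i' 1) : Fin n → F) i =
        (Pi.single i' 1 : Fin n → F) i :=
      congrFun (Submodule.projection_add_projection_eq_self hV' (Pi.single i' 1)) i
    simp only [Submodule.coe_sum, Finset.sum_apply, Submodule.coe_smul, Pi.smul_apply,
      smul_eq_mul] at h2
    rw [Pi.single_apply] at h3
    rw [← h3, ← h2]
    congr 1
    exact Finset.sum_congr rfl fun l _ => mul_comm _ _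

/-- Linear form in block `b`. -/
noncomputable def linF {n : ℕ} (b : Fin 3) (w : Fin n → F) : MvPolynomial (Fin 3 × Fin n) F :=
  ∑ i, C (w i) * X (b, i)

lemma mlo_linF {n : ℕ} (b : Fin 3) (w : Fin n → F) : IsMultilinearOn {b} (linF b w) :=
  mlo_sum _ _ _ fun _ _ => mlo_C_mul _ _ _ (mlo_X _ _)

lemma split_X {n d : ℕ} (b : Fin 3) (P : Fin n → Fin n → F) (c ψ : Fin d → Fin n → F)
    (h : ∀ i i', P i i' + ∑ l, c l i * ψ l i' = if i = i' then 1 else 0) (i : Fin n) :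
    (X (b, i) : MvPolynomial (Fin 3 × Fin n) F) =
      linF b (P i) + ∑ l, C (c l i) * linF b (ψ l) := by
  classical
  have h1 : ∑ i', C (P i i' + ∑ l, c l i * ψ l i') * X (b, i') =
      (X (b, i) : MvPolynomial (Fin 3 × Fin n) F) := by
    simp [h]
  rw [← h1]
  simp only [linF, Finset.mul_sum, map_add, map_sum, map_mul, add_mul, Finset.sum_add_distrib,
    Finset.sum_mul]
  congr 1
  rw [Finset.sum_comm]
  exact Finset.sum_congr rfl fun l _ => Finset.sum_congr rfl fun j _ => by ring

/-- General trilinear expression. -/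
def tri {R : Type*} [CommRing R] {n : ℕ} (a : Fin n → Fin n → Fin n → R) (x y z : Fin n → R) : R :=
  ∑ i, ∑ j, ∑ k, a i j k * (x i * y j * z k)

lemma lin_split {R : Type*} [CommRing R] {n d : ℕ} (L x p : Fin n → R)
    (c : Fin d → Fin n → R) (s : Fin d → R) (h : ∀ i, x i = p i + ∑ l, c l i * s l) :
    ∑ i, x i * L i = ∑ i, p i * L i + ∑ l, s l * ∑ i, c l i * L i := by
  simp only [h, add_mul, Finset.sum_add_distrib, Finset.sum_mul, Finset.mul_sum]
  congr 1
  rw [Finset.sum_comm]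
  exact Finset.sum_congr rfl fun l _ => Finset.sum_congr rfl fun j _ => by ring

lemma tri_eq0 {R : Type*} [CommRing R] {n : ℕ} (a : Fin n → Fin n → Fin n → R)
    (x y z : Fin n → R) :
    tri a x y z = ∑ i, x i * ∑ j, ∑ k, a i j k * (y j * z k) := by
  simp only [tri, Finset.mul_sum]
  exact Finset.sum_congr rfl fun i _ => Finset.sum_congr rfl fun j _ =>
    Finset.sum_congr rfl fun k _ => by ring

lemma tri_eq1 {R : Type*} [CommRing R] {n : ℕ} (a : Fin n → Fin n → Fin n → R)
    (x y z : Fin n → R) :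
    tri a x y z = ∑ j, y j * ∑ i, ∑ k, a i j k * (x i * z k) := by
  simp only [tri, Finset.mul_sum]
  rw [Finset.sum_comm]
  exact Finset.sum_congr rfl fun i _ => Finset.sum_congr rfl fun j _ =>
    Finset.sum_congr rfl fun k _ => by ring

lemma tri_eq2 {R : Type*} [CommRing R] {n : ℕ} (a : Fin n → Fin n → Fin n → R)
    (x y z : Fin n → R) :
    tri a x y z = ∑ k, z k * ∑ i, ∑ j, a i j k * (x i * y j) := by
  simp only [tri, Finset.mul_sum]
  conv_rhs => rw [Finset.sum_comm]
  refine Finset.sum_congr rfl fun i _ => ?_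
  conv_rhs => rw [Finset.sum_comm]
  exact Finset.sum_congr rfl fun j _ =>
    Finset.sum_congr rfl fun k _ => by ring

lemma tri_split0 {R : Type*} [CommRing R] {n d : ℕ} (a : Fin n → Fin n → Fin n → R)
    (x y z p : Fin n → R) (c : Fin d → Fin n → R) (s : Fin d → R)
    (h : ∀ i, x i = p i + ∑ l, c l i * s l) :
    tri a x y z = tri a p y z + ∑ l, s l * tri a (c l) y z := by
  simp only [tri_eq0]
  exact lin_split _ _ _ _ _ h

lemma tri_split1 {R : Type*} [CommRing R] {n d : ℕ} (a : Fin n → Fin n → Fin n → R)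
    (x y z p : Fin n → R) (c : Fin d → Fin n → R) (s : Fin d → R)
    (h : ∀ i, y i = p i + ∑ l, c l i * s l) :
    tri a x y z = tri a x p z + ∑ l, s l * tri a x (c l) z := by
  simp only [tri_eq1]
  exact lin_split _ _ _ _ _ h

lemma tri_split2 {R : Type*} [CommRing R] {n d : ℕ} (a : Fin n → Fin n → Fin n → R)
    (x y z p : Fin n → R) (c : Fin d → Fin n → R) (s : Fin d → R)
    (h : ∀ i, z i = p i + ∑ l, c l i * s l) :
    tri a x y z = tri a x y p + ∑ l, s l * tri a x y (c l) := by
  simp only [tri_eq2]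
  exact lin_split _ _ _ _ _ h

lemma tri_sum0 {R : Type*} [CommRing R] {n d : ℕ} (a : Fin n → Fin n → Fin n → R)
    (x y z : Fin n → R) (c : Fin d → Fin n → R) (s : Fin d → R)
    (h : ∀ i, x i = ∑ l, c l i * s l) :
    tri a x y z = ∑ l, s l * tri a (c l) y z := by
  rw [tri_split0 a x y z 0 c s (by simpa using h)]; simp [tri]

lemma tri_sum1 {R : Type*} [CommRing R] {n d : ℕ} (a : Fin n → Fin n → Fin n → R)
    (x y z : Fin n → R) (c : Fin d → Fin n → R) (s : Fin d → R)
    (h : ∀ i, y i = ∑ l, c l i * s l) :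
    tri a x y z = ∑ l, s l * tri a x (c l) z := by
  rw [tri_split1 a x y z 0 c s (by simpa using h)]; simp [tri]

lemma tri_sum2 {R : Type*} [CommRing R] {n d : ℕ} (a : Fin n → Fin n → Fin n → R)
    (x y z : Fin n → R) (c : Fin d → Fin n → R) (s : Fin d → R)
    (h : ∀ i, z i = ∑ l, c l i * s l) :
    tri a x y z = ∑ l, s l * tri a x y (c l) := by
  rw [tri_split2 a x y z 0 c s (by simpa using h)]; simp [tri]

/-- Slice rank bound from a zero box `V × U × W`. -/
lemma SR_le_box {n : ℕ} (a : Fin n → Fin n → Fin n → F) (V U W : Submodule F (Fin n → F))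
    (h : ∀ x ∈ V, ∀ y ∈ U, ∀ z ∈ W, tri a x y z = 0) :
    SR (triP a) + Module.finrank F V + Module.finrank F U + Module.finrank F W ≤ 3 * n := by
  obtain ⟨P0, d0, c0, ψ0, e0, m0, h0⟩ := split_sub V
  obtain ⟨P1, d1, c1, ψ1, e1, m1, h1⟩ := split_sub U
  obtain ⟨P2, d2, c2, ψ2, e2, m2, h2⟩ := split_sub W
  let A : Fin n → Fin n → Fin n → MvPolynomial (Fin 3 × Fin n) F := fun i j k => C (a i j k)
  have hbase : triP a = tri A (fun i => X (0, i)) (fun i => X (1, i)) (fun i => X (2, i)) := rfl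
  have hz : tri A (fun i => linF 0 (P0 i)) (fun i => linF 1 (P1 i)) (fun i => linF 2 (P2 i)) = 0 := by
    rw [tri_sum0 A (fun i => linF 0 (P0 i)) _ _ (fun l i => C (P0 i l)) (fun l => X (0, l)) (fun i => rfl)]
    refine Finset.sum_eq_zero fun l0 _ => ?_
    rw [tri_sum1 A _ (fun i => linF 1 (P1 i)) _ (fun l i => C (P1 i l)) (fun l => X (1, l)) (fun i => rfl)]
    rw [Finset.sum_eq_zero fun l1 _ => ?_, mul_zero]
    rw [tri_sum2 A _ _ (fun i => linF 2 (P2 i)) (fun l i => C (P2 i l)) (fun l => X (2, l)) (fun i => rfl)]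
    rw [Finset.sum_eq_zero fun l2 _ => ?_, mul_zero]
    have := h _ (m0 l0) _ (m1 l1) _ (m2 l2)
    have h3 := congrArg (C : F → MvPolynomial (Fin 3 × Fin n) F) this
    simp only [tri, map_sum, map_mul, map_zero] at h3
    simp only [tri, A]
    rw [h3, mul_zero]
  rw [tri_split0 A _ _ _ (fun i => linF 0 (P0 i)) (fun l i => C (c0 l i)) (fun l => linF 0 (ψ0 l))
      (fun i => split_X 0 P0 c0 ψ0 h0 i),
    tri_split1 A (fun i => linF 0 (P0 i)) _ _ (fun i => linF 1 (P1 i)) (fun l i => C (c1 l i))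
      (fun l => linF 1 (ψ1 l)) (fun i => split_X 1 P1 c1 ψ1 h1 i),
    tri_split2 A (fun i => linF 0 (P0 i)) (fun i => linF 1 (P1 i)) _ (fun i => linF 2 (P2 i))
      (fun l i => C (c2 l i))
      (fun l => linF 2 (ψ2 l)) (fun i => split_X 2 P2 c2 ψ2 h2 i), hz, zero_add] at hbase
  have key := SR_le (ι := Fin d2 ⊕ (Fin d1 ⊕ Fin d0)) (triP a)
    (Sum.elim (fun _ => 2) (Sum.elim (fun _ => 1) (fun _ => 0)))
    (Sum.elim (fun l => linF 2 (ψ2 l)) (Sum.elim (fun l => linF 1 (ψ1 l)) (fun l => linF 0 (ψ0 l))))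
    (Sum.elim (fun l => tri A (fun i => linF 0 (P0 i)) (fun i => linF 1 (P1 i))
        (fun i => C (c2 l i)))
      (Sum.elim (fun l => tri A (fun i => linF 0 (P0 i)) (fun i => C (c1 l i))
          (fun i => X (2, i)))
        (fun l => tri A (fun i => C (c0 l i)) (fun i => X (1, i)) (fun i => X (2, i)))))
    (by rintro (l | l | l) <;> exact mlo_linF _ _)
    (by
      rintro (l | l | l)
      · have e : ({2} : Finset (Fin 3))ᶜ = {0} ∪ {1} := by decide
        simp only [Sum.elim_inl, e]
        refine mlo_sum _ _ _ fun i _ => mlo_sum _ _ _ fun j _ => mlo_sum _ _ _ fun k _ => ?_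
        rw [mul_comm (linF 0 (P0 i) * _)]
        exact mlo_C_mul _ _ _ (mlo_C_mul _ _ _
          (mlo_mul _ _ _ _ (mlo_linF _ _) (mlo_linF _ _) (by decide)))
      · have e : ({1} : Finset (Fin 3))ᶜ = {0} ∪ {2} := by decide
        simp only [Sum.elim_inl, Sum.elim_inr, e]
        refine mlo_sum _ _ _ fun i _ => mlo_sum _ _ _ fun j _ => mlo_sum _ _ _ fun k _ => ?_
        rw [mul_comm (linF 0 (P0 i)), mul_assoc]
        exact mlo_C_mul _ _ _ (mlo_C_mul _ _ _
          (mlo_mul _ _ _ _ (mlo_linF _ _) (mlo_X _ _) (by decide)))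
      · have e : ({0} : Finset (Fin 3))ᶜ = {1} ∪ {2} := by decide
        simp only [Sum.elim_inr, e]
        refine mlo_sum _ _ _ fun i _ => mlo_sum _ _ _ fun j _ => mlo_sum _ _ _ fun k _ => ?_
        rw [mul_assoc (C _)]
        exact mlo_C_mul _ _ _ (mlo_C_mul _ _ _
          (mlo_mul _ _ _ _ (mlo_X _ _) (mlo_X _ _) (by decide))))
    (by rw [hbase]; simp only [Fintype.sum_sum_type, Sum.elim_inl, Sum.elim_inr]; ring)
  simp only [Fintype.card_sum, Fintype.card_fin] at key
  omega

lemma card_ker [Fintype F] {n : ℕ} (M : Matrix (Fin n) (Fin n) F) :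
    Nat.card (LinearMap.ker M.mulVecLin) = Fintype.card F ^ (n - M.rank) := by
  classical
  rw [Module.natCard_eq_pow_finrank (K := F), Nat.card_eq_fintype_card]
  congr 1
  have := M.mulVecLin.finrank_range_add_finrank_ker
  rw [Module.finrank_fin_fun] at this
  rw [Matrix.rank]
  omega

lemma card_filter_ker [Fintype F] {n : ℕ} (M : Matrix (Fin n) (Fin n) F)
    (Q : (Fin n → F) → Prop) [DecidablePred Q] (hQ : ∀ v, Q v ↔ v ∈ LinearMap.ker M.mulVecLin) :
    (Finset.univ.filter Q).card = Fintype.card F ^ (n - M.rank) := by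
  classical
  rw [← card_ker, Nat.card_eq_fintype_card, Fintype.card_subtype]
  congr 1
  ext v
  simp [hQ]

/-- Contraction in the first slot. -/
def matA {n : ℕ} (a : Fin n → Fin n → Fin n → F) (x : Fin n → F) : Matrix (Fin n) (Fin n) F :=
  Matrix.of fun j k => ∑ i, x i * a i j k

/-- Contraction in the second slot. -/
def matB {n : ℕ} (a : Fin n → Fin n → Fin n → F) (y : Fin n → F) : Matrix (Fin n) (Fin n) F :=
  Matrix.of fun i k => ∑ j, y j * a i j k

lemma mem_kerA {n : ℕ} (a : Fin n → Fin n → Fin n → F) (x y : Fin n → F) :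
    (∀ k, ∑ i, ∑ j, a i j k * (x i * y j) = 0) ↔
      y ∈ LinearMap.ker (matA a x).transpose.mulVecLin := by
  rw [LinearMap.mem_ker, funext_iff]
  refine forall_congr' fun k => ?_
  simp only [Matrix.mulVecLin_apply, Matrix.mulVec, dotProduct, Matrix.transpose_apply, matA,
    Matrix.of_apply, Pi.zero_apply, Finset.sum_mul]
  rw [Finset.sum_comm]
  refine Eq.congr_left (Finset.sum_congr rfl fun j _ => Finset.sum_congr rfl fun i _ => by ring)

lemma mem_kerB {n : ℕ} (a : Fin n → Fin n → Fin n → F) (x y : Fin n → F) :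
    (∀ k, ∑ i, ∑ j, a i j k * (x i * y j) = 0) ↔
      x ∈ LinearMap.ker (matB a y).transpose.mulVecLin := by
  rw [LinearMap.mem_ker, funext_iff]
  refine forall_congr' fun k => ?_
  simp only [Matrix.mulVecLin_apply, Matrix.mulVec, dotProduct, Matrix.transpose_apply, matB,
    Matrix.of_apply, Pi.zero_apply, Finset.sum_mul]
  refine Eq.congr_left (Finset.sum_congr rfl fun j _ => Finset.sum_congr rfl fun i _ => by ring)

lemma matA_sum {n m : ℕ} (a : Fin n → Fin n → Fin n → F) (p : Fin m → F)
    (v : Fin m → Fin n → F) : ∑ k, p k • matA a (v k) = matA a (∑ k, p k • v k) := by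
  ext j k
  simp only [Matrix.sum_apply, Matrix.smul_apply, matA, Matrix.of_apply, Finset.sum_apply,
    Pi.smul_apply, smul_eq_mul, Finset.mul_sum, Finset.sum_mul]
  rw [Finset.sum_comm]
  exact Finset.sum_congr rfl fun j _ => Finset.sum_congr rfl fun i _ => by ring

/-- For each `y`, slice rank bound. -/
lemma SR_le_fiber [Fintype F] {n : ℕ} (a : Fin n → Fin n → Fin n → F) (y : Fin n → F)
    (Q : (Fin n → F) → Prop) [DecidablePred Q]
    (hQ : ∀ x, Q x ↔ x ∈ LinearMap.ker (matB a y).transpose.mulVecLin) :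
    ∃ r : ℕ, SR (triP a) ≤ (matB a y).rank + 2 * r ∧
      Fintype.card F * (r * Fintype.card F ^ (n - (matB a y).rank)) ≤
        Fintype.card F * (∑ x ∈ Finset.univ.filter Q, (matA a x).rank) +
          r * Fintype.card F ^ (n - (matB a y).rank) := by
  classical
  set V := LinearMap.ker (matB a y).transpose.mulVecLin with hV
  have hm : Module.finrank F V = n - (matB a y).rank := by
    have h1 : Module.finrank F (LinearMap.range (matB a y).transpose.mulVecLin) +
        Module.finrank F V = Module.finrank F (Fin n → F) :=
      (matB a y).transpose.mulVecLin.finrank_range_add_finrank_ker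
    rw [Module.finrank_fin_fun] at h1
    have h2 : Module.finrank F (LinearMap.range (matB a y).transpose.mulVecLin) =
      (matB a y).rank := (matB a y).rank_transpose
    omega
  have hrk : (matB a y).rank ≤ n := by simpa using (matB a y).rank_le_width
  let b := Module.finBasis F V
  obtain ⟨r, U, W, hU, hW, hvan, hcard⟩ := core_s6 (fun k => matA a (b k : Fin n → F))
  refine ⟨r, ?_, ?_⟩
  · have := SR_le_box a V U W ?_
    · omega
    · intro x hx u hu w hw
      have hxs := congrArg Subtype.val (b.sum_repr ⟨x, hx⟩)
      simp only [Submodule.coe_sum, Submodule.coe_smul] at hxs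
      have hx2 : ∀ i, x i = ∑ l, (b l : Fin n → F) i * b.repr ⟨x, hx⟩ l := by
        intro i
        rw [← congrFun hxs i]
        simp [Finset.sum_apply, mul_comm]
      rw [tri_sum0 a x u w (fun l => (b l : Fin n → F)) _ hx2]
      refine Finset.sum_eq_zero fun l _ => ?_
      rw [← mul_zero (b.repr ⟨x, hx⟩ l), ← hvan l u hu w hw]
      congr 1
      simp only [tri, matA, Matrix.of_apply, Finset.sum_mul]
      rw [Finset.sum_comm]
      refine Finset.sum_congr rfl fun j _ => ?_
      rw [Finset.sum_comm]
      exact Finset.sum_congr rfl fun j _ => Finset.sum_congr rfl fun i _ => by ring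
  · rw [← hm]
    convert! hcard using 3
    simp only [matA_sum]
    rw [Finset.sum_subtype (p := fun x => x ∈ V) _ (fun x => by simp [hQ])]
    rw [← b.equivFun.symm.toEquiv.sum_comp]
    refine Finset.sum_congr (by congr!) fun p _ => ?_
    congr 2
    simp [Module.Basis.equivFun_symm_apply]

lemma SR_le_AR [Fintype F] {n : ℕ} (a : Fin n → Fin n → Fin n → F) :
    (SR (triP a) : ℝ) ≤ (3 + 2 / ((Fintype.card F : ℝ) - 1)) * AR (triP a) := by
  classical
  set q := Fintype.card F with hq
  have hq1 : 1 < q := Fintype.one_lt_card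
  have hqR : (1 : ℝ) < q := by exact_mod_cast hq1
  let Q : (Fin n → F) → (Fin n → F) → Prop := fun x y => ∀ k, ∑ i, ∑ j, a i j k * (x i * y j) = 0
  let rA : (Fin n → F) → ℕ := fun x => (matA a x).rank
  let rB : (Fin n → F) → ℕ := fun y => (matB a y).rank
  have cA : ∀ x, (Finset.univ.filter fun y => Q x y).card = q ^ (n - rA x) := by
    intro x
    have := card_filter_ker (matA a x).transpose (fun y => Q x y) (fun y => mem_kerA a x y)
    rwa [Matrix.rank_transpose] at this
  have cB : ∀ y, (Finset.univ.filter fun x => Q x y).card = q ^ (n - rB y) := by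
    intro y
    have := card_filter_ker (matB a y).transpose (fun x => Q x y) (fun x => mem_kerB a x y)
    rwa [Matrix.rank_transpose] at this
  have hcF : Fintype.card (Fin n → F) = q ^ n := by simp [hq]
  let N : ℝ := ((Finset.univ.filter fun p : (Fin n → F) × (Fin n → F) => Q p.1 p.2).card : ℝ)
  have hAR : AR (triP a) = - Real.logb q (N / (q ^ n * q ^ n)) := by
    rw [AR, bias, Fintype.card_prod, hcF]
    simp only [sub01_triP, N, Q]
    push_cast
    congr!
  have hind : N = ∑ x, ∑ y, if Q x y then (1 : ℝ) else 0 := by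
    simp only [N]
    rw [Finset.card_filter, Fintype.sum_prod_type]
    push_cast
    rfl
  have hNA : ∑ x, (q : ℝ) ^ (n - rA x) = N := by
    rw [hind]
    refine Finset.sum_congr rfl fun x _ => ?_
    rw [Finset.sum_boole, cA x]; push_cast; rfl
  have hNB : ∑ y, (q : ℝ) ^ (n - rB y) = N := by
    rw [hind, Finset.sum_comm]
    refine Finset.sum_congr rfl fun y _ => ?_
    rw [Finset.sum_boole, cB y]; push_cast; rfl
  have hA := entropy_bound q n hq1 hcF rA
    (fun x => by simpa using (matA a x).rank_le_width) N hNA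
  have hB := entropy_bound q n hq1 hcF rB
    (fun x => by simpa using (matB a x).rank_le_width) N hNB
  rw [← hAR] at hA hB
  set α := AR (triP a) with hα
  have hA2 : ∑ x, (q : ℝ) ^ (n - rA x) * rA x =
      ∑ y, ∑ x ∈ Finset.univ.filter (fun x => Q x y), (rA x : ℝ) := by
    simp only [Finset.sum_filter]
    rw [Finset.sum_comm]
    refine Finset.sum_congr rfl fun x _ => ?_
    rw [← Finset.sum_filter, Finset.sum_const, cA x, nsmul_eq_mul]; push_cast; rfl
  set κ : ℝ := 2 * q / (q - 1) with hκ
  have hq0 : (0 : ℝ) < q - 1 := by linarith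
  have hκ0 : 0 ≤ κ := by positivity
  obtain ⟨y, -, hy⟩ := Finset.exists_le_of_sum_le (s := Finset.univ)
    (f := fun y => (q : ℝ) ^ (n - rB y) * rB y +
      κ * ∑ x ∈ Finset.univ.filter (fun x => Q x y), (rA x : ℝ))
    (g := fun y => (q : ℝ) ^ (n - rB y) * ((1 + κ) * α)) ⟨0, Finset.mem_univ _⟩ (by
      rw [Finset.sum_add_distrib, ← Finset.mul_sum, ← hA2, ← Finset.sum_mul, hNB]
      nlinarith)
  obtain ⟨r, hr1, hr2⟩ := SR_le_fiber a y (fun x => Q x y) (fun x => mem_kerB a x y)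
  have hr1' : (SR (triP a) : ℝ) ≤ rB y + 2 * r := by exact_mod_cast hr1
  have hr2' : (q : ℝ) * (r * q ^ (n - rB y)) ≤
      q * (∑ x ∈ Finset.univ.filter (fun x => Q x y), (rA x : ℝ)) + r * q ^ (n - rB y) := by
    exact_mod_cast hr2
  set S := ∑ x ∈ Finset.univ.filter (fun x => Q x y), (rA x : ℝ) with hS
  have hpos : (0 : ℝ) < (q : ℝ) ^ (n - rB y) := by positivity
  set D := (q : ℝ) ^ (n - rB y) with hD
  have hκS : 2 * r * D ≤ κ * S := by
    rw [hκ, div_mul_eq_mul_div, le_div_iff₀ hq0]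
    nlinarith
  have hfin : D * (rB y + 2 * r) ≤ D * ((1 + κ) * α) := by
    have : D * rB y + κ * S ≤ D * ((1 + κ) * α) := hy
    nlinarith
  have hfin2 := le_of_mul_le_mul_left hfin hpos
  have hc : 1 + κ = 3 + 2 / ((q : ℝ) - 1) := by
    rw [hκ]; field_simp; ring
  rw [← hc]
  linarith
end Slices

/-- For any 3-tensor over `F_q`, `SR(T) ≤ (3 + 2/(q−1)) · AR(T)`. -/
theorem statement_6 (F : Type*) [Field F] [Fintype F] (n : ℕ) (hn : 1 ≤ n)
    (T : MvPolynomial (Fin 3 × Fin n) F) (hT : IsMultilinear T) :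
    (SR T : ℝ) ≤ (3 + 2 / ((Fintype.card F : ℝ) - 1)) * AR T := by
  obtain ⟨a, rfl⟩ := exists_triP T hT
  exact SR_le_AR a
end

section
/- For any 3-tensor T over F_q and any real number a ≥ 0, there exists a linear subspace U ⊆ F_q^n such that a · E_{x ∈ U}[rank mat(T)(x)] + codim U ≤ (a + 1) · AR(T), where the expectation is over a uniformly random x ∈ U. -/
open MvPolynomial

open Classical in
/-- Entropy (Jensen) inequality. -/
lemma jensen_aux {ι : Type*} [Fintype ι] [Nonempty ι] (q : ℝ) (hq : 1 < q) (r : ι → ℝ)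
    (w : ι → ℝ) (hw : ∀ i, w i = q ^ (- r i)) :
    ∑ i, w i * r i ≤ (∑ i, w i) * (- Real.logb q ((∑ i, w i) / Fintype.card ι)) := by
  have hq0 : 0 < q := by linarith
  have hlq : 0 < Real.log q := Real.log_pos hq
  have hwp : ∀ i, 0 < w i := fun i => by rw [hw]; positivity
  have hc : (0 : ℝ) < Fintype.card ι := by exact_mod_cast Fintype.card_pos
  have J := Real.convexOn_mul_log.map_sum_le (t := Finset.univ)
    (w := fun _ : ι => (1 : ℝ) / Fintype.card ι) (p := w)
    (fun i _ => by positivity) (by simp [hc.ne']) (fun i _ => (hwp i).le)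
  simp only [smul_eq_mul, ← Finset.mul_sum] at J
  have hlog : ∀ i, Real.log (w i) = - r i * Real.log q := fun i => by
    rw [hw, Real.log_rpow hq0]
  have h1 : ∑ i, w i * Real.log (w i) = - (∑ i, w i * r i) * Real.log q := by
    rw [← Finset.sum_neg_distrib, Finset.sum_mul]
    exact Finset.sum_congr rfl fun i _ => by rw [hlog]; ring
  rw [h1] at J
  have e : (1 : ℝ) / Fintype.card ι * ∑ i, w i = (∑ i, w i) / Fintype.card ι := by ring
  rw [e] at J
  set S := ∑ i, w i
  set R := ∑ i, w i * r i
  have J2 : S * Real.log (S / Fintype.card ι) ≤ - R * Real.log q := by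
    have := mul_le_mul_of_nonneg_left J hc.le
    field_simp at this
    linarith
  unfold Real.logb
  rw [← neg_div, ← mul_div_assoc, le_div_iff₀ hlq]
  linarith

lemma trilinear_form {F : Type*} [Field F] {n : ℕ}
    (T : MvPolynomial (Fin 3 × Fin n) F) (hT : IsMultilinear T) :
    ∃ c : Fin n → Fin n → Fin n → F,
      T = ∑ i, ∑ j, ∑ k, C (c i j k) * (X (0, i) * X (1, j) * X (2, k)) := by
  rw [T.as_sum]
  refine Finset.sum_induction _ (fun T : MvPolynomial (Fin 3 × Fin n) F =>
    ∃ c : Fin n → Fin n → Fin n → F,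
      T = ∑ i, ∑ j, ∑ k, C (c i j k) * (X (0, i) * X (1, j) * X (2, k))) ?_ ?_ ?_
  · rintro _ _ ⟨c, rfl⟩ ⟨d, rfl⟩
    refine ⟨fun i j k => c i j k + d i j k, ?_⟩
    simp only [C_add, add_mul, Finset.sum_add_distrib]
  · exact ⟨fun _ _ _ => 0, by simp⟩
  · intro m hm
    have h := hT m hm
    have key : ∀ b : Fin 3, ∃ i : Fin n, ∀ j, m (b, j) = if j = i then 1 else 0 := by
      intro b
      have hb := h b
      simp only [Finset.mem_univ, if_true] at hb
      obtain ⟨i, _, hi⟩ := Finset.exists_ne_zero_of_sum_ne_zero (by rw [hb]; exact one_ne_zero)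
      refine ⟨i, fun j => ?_⟩
      rw [← Finset.add_sum_erase _ _ (Finset.mem_univ i)] at hb
      have h0 : ∑ j ∈ Finset.univ.erase i, m (b, j) = 0 := by omega
      rw [Finset.sum_eq_zero_iff] at h0
      split_ifs with hji
      · subst hji; omega
      · exact h0 j (by simp [hji])
    obtain ⟨i0, h0⟩ := key 0
    obtain ⟨i1, h1⟩ := key 1
    obtain ⟨i2, h2⟩ := key 2
    have hm' : m = Finsupp.single (0, i0) 1 + Finsupp.single (1, i1) 1
        + Finsupp.single (2, i2) 1 := by
      ext ⟨b, j⟩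
      fin_cases b
      · simp [h0, Finsupp.single_apply, eq_comm]
      · simp [h1, Finsupp.single_apply, eq_comm]
      · simp [h2, Finsupp.single_apply, eq_comm]
    refine ⟨fun i j k => if i = i0 then if j = i1 then if k = i2 then coeff m T else 0 else 0
      else 0, ?_⟩
    rw [Finset.sum_eq_single i0, Finset.sum_eq_single i1, Finset.sum_eq_single i2]
    · simp only [if_true]
      rw [X, X, X, monomial_mul, monomial_mul, C_mul_monomial, ← hm']
      simp
    all_goals simp +contextual

lemma matT_entry {F : Type*} [Field F] {n : ℕ} (c : Fin n → Fin n → Fin n → F)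
    (x : Fin n → F) (j k : Fin n) :
    matT (∑ i, ∑ j, ∑ k, C (c i j k) * (X (0, i) * X (1, j) * X (2, k))) x j k
      = ∑ i, c i j k * x i := by
  simp [matT, map_sum]

lemma sub01_zero_iff {F : Type*} [Field F] {n : ℕ} (c : Fin n → Fin n → Fin n → F)
    (x y : Fin n → F) :
    sub01 (∑ i, ∑ j, ∑ k, C (c i j k) * (X (0, i) * X (1, j) * X (2, k))) x y = 0
      ↔ ∀ k, ∑ j, (∑ i, c i j k * x i) * y j = 0 := by
  have e : sub01 (∑ i, ∑ j, ∑ k, C (c i j k) * (X (0, i) * X (1, j) * X (2, k))) x y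
      = ∑ k, C (∑ j, (∑ i, c i j k * x i) * y j) * X ((2 : Fin 3), k) := by
    simp only [sub01, map_sum, map_mul, aeval_X, aeval_C, Finset.sum_mul]
    rw [Finset.sum_comm]
    conv_lhs => enter [2, j]; rw [Finset.sum_comm]
    rw [Finset.sum_comm]
    refine Finset.sum_congr rfl fun k _ => Finset.sum_congr rfl fun j _ =>
      Finset.sum_congr rfl fun i _ => ?_
    simp [algebraMap_eq, mul_assoc]
  rw [e]
  constructor
  · intro h k
    have := congrArg (eval fun v : Fin 3 × Fin n => if v.2 = k then (1 : F) else 0) h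
    simpa [map_sum] using this
  · intro h
    simp only [h]; simp

/-- counting solutions of a linear system -/
lemma card_ker_s8 {F : Type*} [Field F] [Fintype F] {n : ℕ}
    (U : Submodule F (Fin n → F)) [Fintype U] :
    (Fintype.card U : ℝ) / (Fintype.card F : ℝ) ^ n
      = (Fintype.card F : ℝ) ^ (-(((n - Module.finrank F U : ℕ) : ℝ))) := by
  have hq : (0 : ℝ) < Fintype.card F := by exact_mod_cast Fintype.card_pos
  have hle : Module.finrank F U ≤ n := by
    simpa using Submodule.finrank_le U
  rw [Module.card_eq_pow_finrank (K := F) (V := U), Real.rpow_neg hq.le, Real.rpow_natCast,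
    Nat.cast_pow, div_eq_iff (by positivity), eq_comm, inv_mul_eq_iff_eq_mul₀ (by positivity),
    ← pow_add]
  congr 1; omega

open Classical in
theorem statement_8 (F : Type*) [Field F] [Fintype F] (n : ℕ) (hn : 1 ≤ n)
    (T : MvPolynomial (Fin 3 × Fin n) F) (hT : IsMultilinear T)
    (a : ℝ) (ha : 0 ≤ a) :
    ∃ U : Submodule F (Fin n → F),
      a * ((∑ x : U, ((matT T (x : Fin n → F)).rank : ℝ)) / (Fintype.card U : ℝ)) +
        ((n - Module.finrank F U : ℕ) : ℝ) ≤ (a + 1) * AR T := by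
  obtain ⟨c, rfl⟩ := trilinear_form T hT
  set T := ∑ i, ∑ j, ∑ k, C (c i j k) * (X ((0 : Fin 3), i) * X (1, j) * X (2, k)) with hTdef
  have hq1 : (1 : ℝ) < Fintype.card F := by exact_mod_cast Fintype.one_lt_card
  set q : ℝ := (Fintype.card F : ℝ) with hq
  have hq0 : 0 < q := by linarith
  -- the relation
  let P : (Fin n → F) → (Fin n → F) → Prop := fun x y => sub01 T x y = 0
  have hP : ∀ x y, P x y ↔ ∀ k, ∑ j, (∑ i, c i j k * x i) * y j = 0 :=
    fun x y => sub01_zero_iff c x y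
  let U : (Fin n → F) → Submodule F (Fin n → F) := fun y =>
    { carrier := {x | P x y}
      add_mem' := by
        intro x x' h h'
        simp only [Set.mem_ofPred_eq, hP] at *
        intro k
        simp [mul_add, add_mul, Finset.sum_add_distrib, h k, h' k]
      zero_mem' := by simp [hP]
      smul_mem' := by
        intro t x h
        simp only [Set.mem_ofPred_eq, hP] at *
        intro k
        have := congrArg (t * ·) (h k)
        simp only [Finset.mul_sum, Finset.sum_mul, mul_zero] at this ⊢
        rw [← this]
        refine Finset.sum_congr rfl fun j _ => Finset.sum_congr rfl fun i _ => ?_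
        simp; ring }
  let K : (Fin n → F) → Submodule F (Fin n → F) := fun x =>
    LinearMap.ker ((matT T x).transpose).mulVecLin
  have hU : ∀ x y, x ∈ U y ↔ P x y := fun x y => Iff.rfl
  have hK : ∀ x y, y ∈ K x ↔ P x y := fun x y => by
    simp only [K, LinearMap.mem_ker, Matrix.mulVecLin_apply, hP, funext_iff]
    refine forall_congr' fun k => ?_
    simp only [Matrix.mulVec, dotProduct, Matrix.transpose_apply, hTdef, matT_entry,
      Pi.zero_apply]
  have hrank : ∀ x, (n - Module.finrank F (K x) : ℕ) = (matT T x).rank := fun x => by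
    have h := LinearMap.finrank_range_add_finrank_ker ((matT T x).transpose).mulVecLin
    rw [← Matrix.rank_transpose, Matrix.rank]
    simp only [Module.finrank_fin_fun] at h
    simp only [K]
    omega
  -- counts
  have cU : ∀ y, (Fintype.card (U y) : ℝ) = ∑ x, if P x y then 1 else 0 := fun y => by
    rw [Finset.sum_boole, Fintype.card_subtype]; simp only [hU]
  have cK : ∀ x, (Fintype.card (K x) : ℝ) = ∑ y, if P x y then 1 else 0 := fun x => by
    rw [Finset.sum_boole, Fintype.card_subtype]; simp only [hK]
  set N : ℝ := ∑ x, ∑ y, if P x y then 1 else 0 with hN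
  have sK : ∑ x, (Fintype.card (K x) : ℝ) = N := by simp only [cK, hN]
  have sU : ∑ y, (Fintype.card (U y) : ℝ) = N := by
    simp only [cU, hN]; exact Finset.sum_comm
  have hcard : (Fintype.card (Fin n → F) : ℝ) = q ^ n := by simp [hq]
  have hbias : bias T = N / q ^ n / q ^ n := by
    unfold bias
    rw [Fintype.card_prod, Nat.cast_mul, hcard, div_div]
    congr 1
    rw [hN, ← Finset.sum_boole, Fintype.sum_prod_type]
  have hqn : 0 < q ^ n := by positivity
  have jU := jensen_aux q hq1 (fun y => ((n - Module.finrank F (U y) : ℕ) : ℝ))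
    (fun y => (Fintype.card (U y) : ℝ) / q ^ n) (fun y => card_ker_s8 (U y))
  have jK := jensen_aux q hq1 (fun x => ((n - Module.finrank F (K x) : ℕ) : ℝ))
    (fun x => (Fintype.card (K x) : ℝ) / q ^ n) (fun x => card_ker_s8 (K x))
  simp only [← Finset.sum_div, sU, sK, hcard, ← hbias, div_mul_eq_mul_div] at jU jK
  rw [div_le_div_iff_of_pos_right hqn] at jU jK
  change _ ≤ N * AR T at jU
  change _ ≤ N * AR T at jK
  simp only [hrank] at jK
  by_contra! hcon
  have hpos : ∀ y, (0 : ℝ) < Fintype.card (U y) := fun y => by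
    exact_mod_cast Fintype.card_pos
  have hlt : ∑ y, (Fintype.card (U y) : ℝ) * ((a + 1) * AR T) <
      ∑ y, (a * (∑ x : U y, ((matT T (x : Fin n → F)).rank : ℝ)) +
        (Fintype.card (U y) : ℝ) * ((n - Module.finrank F (U y) : ℕ) : ℝ)) := by
    refine Finset.sum_lt_sum_of_nonempty Finset.univ_nonempty fun y _ => ?_
    have := mul_lt_mul_of_pos_left (hcon (U y)) (hpos y)
    have hne := (hpos y).ne'
    calc _ < _ := this
      _ = _ := by field_simp
  rw [← Finset.sum_mul, sU, Finset.sum_add_distrib, ← Finset.mul_sum] at hlt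
  have hswap : ∑ y, ∑ x : U y, ((matT T (x : Fin n → F)).rank : ℝ)
      = ∑ x, (Fintype.card (K x) : ℝ) * ((matT T x).rank : ℝ) := by
    simp only [cK, Finset.sum_mul]
    rw [Finset.sum_comm]
    refine Finset.sum_congr rfl fun y _ => ?_
    simp only [ite_mul, one_mul, zero_mul]
    rw [← Finset.sum_filter]
    exact (Finset.sum_subtype _ (by simp [hU]) (fun x => ((matT T x).rank : ℝ))).symm
  rw [hswap] at hlt
  have := mul_le_mul_of_nonneg_left jK ha
  linarith
end
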